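/- arXiv:2212.01604 — 6 statements merged into one kernel-verified Lean document; each statement's English description precedes it below -/
import Mathlib

section
/- Assume cov(N̄) = 𝔠, i.e., the real line is not the union of fewer than continuum many closed sets of Lebesgue measure zero. Every zero-closed semigroup X admitting a compact Hausdorff semigroup topology is polyfinite. -/
open Cardinal Pointwise

universe u

namespace ZeroClosedPaper

/-- The value of the semigroup polynomial with coefficient list `a = [a₀, a₁, …, aₙ]`
(coefficients in `X¹ = WithOne X`) at the point `x`, i.e. `a₀xa₁x⋯xaₙ`,
computed in the monoid `WithOne X`. Its degree (the number of occurrences of `x`)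
is `a.length - 1`. -/
def polyVal {X : Type*} [Semigroup X] (a : List (WithOne X)) (x : X) : WithOne X :=
  match a with
  | [] => 1
  | a₀ :: rest => a₀ * (rest.map (fun ai => (x : WithOne X) * ai)).prod

/-- A subset `A` of a semigroup `X` is algebraic if
`A = {x ∈ X : a₀xa₁⋯xaₙ = b}` for some `n ≥ 1`, `b ∈ X` and `a₀,…,aₙ ∈ X¹`. -/
def IsAlgebraicSet {X : Type*} [Semigroup X] (A : Set X) : Prop :=
  ∃ (a : List (WithOne X)) (b : X), 2 ≤ a.length ∧
    A = {x : X | polyVal a x = (b : WithOne X)}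

/-- The polyboundedness number `cov(A_X)`: the smallest cardinality of a cover of `X`
by algebraic subsets of `X`. -/
noncomputable def covA (X : Type*) [Semigroup X] : Cardinal :=
  sInf {c : Cardinal | ∃ C : Set (Set X), (∀ A ∈ C, IsAlgebraicSet A) ∧
    ⋃₀ C = Set.univ ∧ Cardinal.mk ↥C = c}

/-- A subset `S` of a semigroup `X` is polybounded in `X` if it can be covered by
finitely many algebraic subsets of `X`. -/
def PolyboundedIn {X : Type*} [Semigroup X] (S : Set X) : Prop :=
  ∃ C : Set (Set X), C.Finite ∧ (∀ A ∈ C, IsAlgebraicSet A) ∧ S ⊆ ⋃₀ C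

/-- A semigroup is polybounded if it admits a finite cover by algebraic sets. -/
def Polybounded (X : Type*) [Semigroup X] : Prop :=
  PolyboundedIn (Set.univ : Set X)

/-- A semigroup `X` is polyfinite if there are `n ∈ ℕ` and a finite `F ⊆ X` such that
for all `x, y ∈ X` some semigroup polynomial `f` of degree `≤ n` has `f(x), f(y) ∈ F`. -/
def Polyfinite (X : Type*) [Semigroup X] : Prop :=
  ∃ (n : ℕ) (F : Set X), F.Finite ∧ ∀ x y : X, ∃ a : List (WithOne X),
    2 ≤ a.length ∧ a.length ≤ n + 1 ∧
    (∃ u ∈ F, polyVal a x = (u : WithOne X)) ∧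
    (∃ v ∈ F, polyVal a y = (v : WithOne X))

/-- A semigroup `X` is zero-closed if `X` is closed in its `0`-extension
`X⁰ = WithZero X` endowed with any Hausdorff semigroup topology. -/
def ZeroClosed (X : Type*) [Semigroup X] : Prop :=
  ∀ τ : TopologicalSpace (WithZero X),
    @T2Space (WithZero X) τ → @ContinuousMul (WithZero X) τ _ →
    @IsClosed (WithZero X) τ (Set.range ((↑) : X → WithZero X))

/-- `d` is a pseudometric. -/
def IsPseudometric {X : Type*} (d : X → X → ℝ) : Prop :=
  (∀ x, d x x = 0) ∧ (∀ x y, d x y = d y x) ∧ (∀ x y z, d x z ≤ d x y + d y z)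

/-- `d` is subinvariant: `d(axb, ayb) ≤ d(x,y)` for all `a, b ∈ X¹`
(equivalently, `d` is both left- and right-nonexpansive under translations). -/
def Subinvariant {X : Type*} [Semigroup X] (d : X → X → ℝ) : Prop :=
  (∀ a x y : X, d (a * x) (a * y) ≤ d x y) ∧
  (∀ b x y : X, d (x * b) (y * b) ≤ d x y)

/-- `d` is separable: some countable set is `d`-dense. -/
def SeparablePseudometric {X : Type*} (d : X → X → ℝ) : Prop :=
  ∃ C : Set X, C.Countable ∧ ∀ x : X, ∀ ε : ℝ, 0 < ε → ∃ c ∈ C, d x c < ε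

/-- `cov(M)`: the smallest cardinality of a cover of the real line by meager sets. -/
noncomputable def covMeager : Cardinal :=
  sInf {c : Cardinal | ∃ S : Set (Set ℝ), (∀ A ∈ S, IsMeagre A) ∧
    ⋃₀ S = Set.univ ∧ Cardinal.mk ↥S = c}

/-- `cov(N̄)`: the smallest cardinality of a cover of the real line by closed
Lebesgue-null sets. -/
noncomputable def covClosedNull : Cardinal :=
  sInf {c : Cardinal | ∃ S : Set (Set ℝ),
    (∀ A ∈ S, IsClosed A ∧ MeasureTheory.volume A = 0) ∧
    ⋃₀ S = Set.univ ∧ Cardinal.mk ↥S = c}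

/-- A topological space is power-Lindelöf if each finite power is Lindelöf. -/
def PowerLindelof (Y : Type*) [TopologicalSpace Y] : Prop :=
  ∀ n : ℕ, LindelofSpace (Fin n → Y)

/-- `I` is an ideal of the semigroup `X`. -/
def IsIdeal {X : Type*} [Semigroup X] (I : Set X) : Prop :=
  ∀ x ∈ I, ∀ a : X, x * a ∈ I ∧ a * x ∈ I

/-- `IsPolyMap n f` says that `f` is a semigroup polynomial of degree `n`
all of whose coefficients belong to the semigroup. -/
inductive IsPolyMap {S : Type*} [Semigroup S] : ℕ → (S → S) → Prop
  | const (a : S) : IsPolyMap 0 (fun _ => a)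
  | step (a : S) {n : ℕ} {f : S → S} (hf : IsPolyMap n f) : IsPolyMap (n + 1) (fun x => a * (x * f x))

namespace IsPolyMap

variable {S : Type*} [Semigroup S] {m n : ℕ} {f g : S → S}

theorem const_mul (hf : IsPolyMap n f) (b : S) : IsPolyMap n (fun x => b * f x) := by
  cases hf with
  | const a => exact .const (b * a)
  | step a hf => simpa only [mul_assoc] using IsPolyMap.step (b * a) hf

theorem mul (hf : IsPolyMap m f) (hg : IsPolyMap n g) :
    IsPolyMap (m + n) (fun x => f x * g x) := by
  induction hf with
  | const a => simpa using hg.const_mul a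
  | @step a m f _ ih =>
    have h := IsPolyMap.step a ih
    rw [Nat.add_right_comm] at h
    simpa only [mul_assoc] using h

theorem mul_const (hf : IsPolyMap n f) (b : S) : IsPolyMap n (fun x => f x * b) :=
  hf.mul (.const b)

theorem comp (hf : IsPolyMap m f) (hg : IsPolyMap n g) : IsPolyMap (m * n) (fun x => f (g x)) := by
  induction hf with
  | const a => simpa using IsPolyMap.const a
  | @step a m f _ ih =>
    have h := (hg.mul ih).const_mul a
    rwa [show n + m * n = (m + 1) * n by ring] at h

theorem continuous [TopologicalSpace S] [ContinuousMul S] (hf : IsPolyMap n f) :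
    Continuous f := by
  induction hf with
  | const a => exact continuous_const
  | step a _ ih => exact continuous_const.mul (continuous_id.mul ih)

/-- The pairs of values of the polynomials of a fixed degree at two given points form a
compact set. -/
theorem isCompact_values [TopologicalSpace S] [CompactSpace S] [ContinuousMul S] (x y : S)
    (n : ℕ) : IsCompact {p : S × S | ∃ f, IsPolyMap n f ∧ p = (f x, f y)} := by
  induction n with
  | zero =>
    convert! isCompact_range (continuous_id.prodMk continuous_id : Continuous fun a : S => (a, a))
    ext p
    constructor
    · rintro ⟨f, hf, rfl⟩
      cases hf with
      | const a => exact ⟨a, rfl⟩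
    · rintro ⟨a, rfl⟩
      exact ⟨_, .const a, rfl⟩
  | succ n ih =>
    convert! (isCompact_univ (X := S)).prod ih |>.image
      (f := fun q : S × S × S => (q.1 * (x * q.2.1), q.1 * (y * q.2.2))) (by fun_prop)
    ext p
    constructor
    · rintro ⟨f, hf, rfl⟩
      cases hf with
      | step a hf => exact ⟨(a, _), ⟨trivial, _, hf, rfl⟩, rfl⟩
    · rintro ⟨⟨a, _⟩, ⟨-, f, hf, rfl⟩, rfl⟩
      exact ⟨_, .step a hf, rfl⟩

/-- Polynomials lift along surjective homomorphisms. -/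
theorem exists_lift {T : Type*} [Semigroup T] (φ : T →ₙ* S) (hφ : Function.Surjective φ)
    (hf : IsPolyMap n f) : ∃ g : T → T, IsPolyMap n g ∧ ∀ x, φ (g x) = f (φ x) := by
  induction hf with
  | const a =>
    obtain ⟨b, rfl⟩ := hφ a
    exact ⟨_, .const b, fun _ => rfl⟩
  | step a _ ih =>
    obtain ⟨b, rfl⟩ := hφ a
    obtain ⟨g, hg, h⟩ := ih
    exact ⟨_, .step b hg, fun x => by simp [h]⟩

/-- Polynomials extend along homomorphisms. -/
theorem exists_extend {T : Type*} [Semigroup T] (φ : S →ₙ* T) (hf : IsPolyMap n f) :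
    ∃ g : T → T, IsPolyMap n g ∧ ∀ x, g (φ x) = φ (f x) := by
  induction hf with
  | const a => exact ⟨_, .const (φ a), fun _ => rfl⟩
  | step a _ ih =>
    obtain ⟨g, hg, h⟩ := ih
    exact ⟨_, .step (φ a) hg, fun x => by simp [h]⟩

theorem pow_mul {G : Type*} [Monoid G] (k : ℕ) (h : G) : IsPolyMap k (fun x : G => x ^ k * h) := by
  induction k with
  | zero => simpa using IsPolyMap.const h
  | succ k ih => simpa [pow_succ', mul_assoc] using IsPolyMap.step 1 ih

end IsPolyMap

section polyVal

variable {X : Type*} [Semigroup X]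

theorem polyVal_singleton (s : WithOne X) (x : X) : polyVal [s] x = s := by
  simp [polyVal]

theorem polyVal_cons_cons (s t : WithOne X) (a : List (WithOne X)) (x : X) :
    polyVal (s :: t :: a) x = s * (x * polyVal (t :: a) x) := by
  simp [polyVal, mul_assoc]

theorem IsPolyMap.exists_polyVal {n : ℕ} {f : X → X} (hf : IsPolyMap n f) :
    ∃ a : List (WithOne X), a.length = n + 1 ∧ ∀ x, polyVal a x = (f x : WithOne X) := by
  induction hf with
  | const a => exact ⟨[a], rfl, fun x => polyVal_singleton _ x⟩
  | step a _ ih =>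
    obtain ⟨l, hl, h⟩ := ih
    obtain _ | ⟨t, l⟩ := l
    · simp at hl
    · exact ⟨a :: t :: l, by simpa using hl, fun x => by
        rw [polyVal_cons_cons, h]; simp [WithOne.coe_mul]⟩

/-- If `e` is the identity of a monoid `G ⊆ X` with `eXe ⊆ G`, then cutting down by `e` turns
polynomials on `X` into polynomials on `G`. -/
theorem exists_isPolyMap_of_polyVal {G : Type*} [Monoid G] (ι : G →ₙ* X)
    (ρ : X → G) (hρ : ∀ x, ι (ρ x) = ι 1 * x * ι 1) (a : List (WithOne X)) (ha : a ≠ []) :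
    ∃ f : G → G, IsPolyMap (a.length - 1) f ∧
      ∀ g : G, (ι (f g) : WithOne X) = ι 1 * polyVal a (ι g) * ι 1 := by
  have key : ∀ s : WithOne X, ∃ r : G, (ι r : WithOne X) = ι 1 * s * ι 1 := by
    intro s
    induction s with
    | one => exact ⟨1, by simp [← WithOne.coe_mul, ← map_mul]⟩
    | coe x => exact ⟨ρ x, by simp [hρ]⟩
  induction a with
  | nil => exact absurd rfl ha
  | cons s a ih =>
    obtain ⟨r, hr⟩ := key s
    obtain _ | ⟨t, a⟩ := a
    · exact ⟨_, .const r, fun g => by rw [polyVal_singleton, hr]⟩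
    · obtain ⟨f, hf, h⟩ := ih (by simp)
      refine ⟨_, .step r hf, fun g => ?_⟩
      have h1 : (ι g : WithOne X) = ι 1 * (ι g * ι 1) := by
        simp [← WithOne.coe_mul, ← map_mul]
      rw [polyVal_cons_cons, map_mul, map_mul, WithOne.coe_mul, WithOne.coe_mul, h, hr]
      conv_rhs => rw [h1]
      simp only [mul_assoc]

/-- The values at `x` of the polynomials of degree `n` with coefficients in `M`. -/
def PolyValues (M : Submonoid (WithOne X)) (x : X) (n : ℕ) : Set (WithOne X) :=
  {w | ∃ a : List (WithOne X), a.length = n + 1 ∧ (∀ t ∈ a, t ∈ M) ∧ polyVal a x = w}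

variable {M : Submonoid (WithOne X)} {x : X} {m n : ℕ}

theorem mem_polyValues_zero {w : WithOne X} (hw : w ∈ M) : w ∈ PolyValues M x 0 :=
  ⟨[w], rfl, by simpa using hw, polyVal_singleton _ x⟩

theorem mem_polyValues_one : (x : WithOne X) ∈ PolyValues M x 1 :=
  ⟨[1, 1], rfl, by simp [M.one_mem], by simp [polyVal]⟩

theorem mul_mem_polyValues {v w : WithOne X} (hv : v ∈ PolyValues M x m)
    (hw : w ∈ PolyValues M x n) : v * w ∈ PolyValues M x (m + n) := by
  obtain ⟨a, hal, ha, rfl⟩ := hv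
  obtain ⟨b, hbl, hb, rfl⟩ := hw
  obtain _ | ⟨t, b⟩ := b
  · simp at hbl
  induction a generalizing m with
  | nil => simp at hal
  | cons s a ih =>
    obtain _ | ⟨r, a⟩ := a
    · refine ⟨(s * t) :: b, ?_, ?_, ?_⟩
      · simp at hal hbl ⊢; omega
      · simp only [List.mem_cons, forall_eq_or_imp] at ha hb ⊢
        exact ⟨M.mul_mem ha.1 hb.1, hb.2⟩
      · simp [polyVal, mul_assoc]
    · obtain ⟨c, hcl, hc, h⟩ := ih (m := m - 1) (by simp at hal ⊢; omega)
        (fun t ht => ha t (List.mem_cons_of_mem _ ht))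
      obtain _ | ⟨u, c⟩ := c
      · simp at hcl
      refine ⟨s :: u :: c, ?_, ?_, ?_⟩
      · simp at hal hcl ⊢; omega
      · intro t ht
        obtain rfl | ht := List.mem_cons.1 ht
        · exact ha _ (by simp)
        · exact hc t ht
      · rw [polyVal_cons_cons, polyVal_cons_cons, h]
        simp only [mul_assoc]

theorem PolyValues.mem_of_le {N : Submonoid (WithOne X)} (hMN : M ≤ N) (hx : (x : WithOne X) ∈ N)
    {w : WithOne X} (hw : w ∈ PolyValues M x n) : w ∈ N := by
  obtain ⟨a, -, ha, rfl⟩ := hw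
  induction a with
  | nil => exact N.one_mem
  | cons s a ih =>
    have hs := hMN (ha s (by simp))
    obtain _ | ⟨r, a⟩ := a
    · rwa [polyVal_singleton]
    · rw [polyVal_cons_cons]
      exact N.mul_mem hs (N.mul_mem hx (ih fun t ht => ha t (List.mem_cons_of_mem _ ht)))

end polyVal

section Filter

open Filter Topology

/-- A zero-closed semigroup carries no filter that could serve as the trace of the neighborhood
filter of zero in a Hausdorff semigroup topology with discrete `X`. -/
theorem ZeroClosed.not_filter {X : Type*} [Semigroup X] (hz : ZeroClosed X) (F : Filter X)
    [F.NeBot] (hfree : ∀ x : X, {x}ᶜ ∈ F) (hmul : Tendsto (fun p : X × X => p.1 * p.2) (F ×ˢ F) F)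
    (hl : ∀ a : X, Tendsto (a * ·) F F) (hr : ∀ a : X, Tendsto (· * a) F F) : False := by
  let τ : TopologicalSpace (WithZero X) := nhdsAdjoint 0 (F.map (↑))
  have n0 : 𝓝 (0 : WithZero X) = pure 0 ⊔ F.map (↑) := nhds_nhdsAdjoint_same _ _
  have nx (x : X) : 𝓝 (x : WithZero X) = pure (x : WithZero X) :=
    nhds_nhdsAdjoint_of_ne _ (WithZero.coe_ne_zero)
  have hdisj (x : X) : Disjoint (𝓝 (x : WithZero X)) (𝓝 0) := by
    rw [nx, n0, Filter.disjoint_iff]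
    refine ⟨{(x : WithZero X)}, rfl, {(x : WithZero X)}ᶜ, ?_, disjoint_compl_right⟩
    refine mem_sup.2 ⟨?_, ?_⟩
    · simp
    · refine mem_map.2 (mem_of_superset (hfree x) fun y hy => ?_)
      simpa using hy
  have t2 : T2Space (WithZero X) := by
    refine t2Space_iff_disjoint_nhds.2 fun u v huv => ?_
    induction u with
    | zero =>
      induction v with
      | zero => exact absurd rfl huv
      | coe y => exact (hdisj y).symm
    | coe x =>
      induction v with
      | zero => exact hdisj x
      | coe y => simpa [nx] using huv
  have coe_tendsto : Tendsto ((↑) : X → WithZero X) F (𝓝 0) := by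
    rw [n0]; exact le_sup_right
  have hzl (l : Filter (WithZero X)) : Tendsto (fun p => p.1 * p.2) (pure 0 ×ˢ l) (𝓝 0) := by
    rw [pure_prod, tendsto_map'_iff]
    simpa [Function.comp_def] using tendsto_const_nhds
  have hzr (l : Filter (WithZero X)) : Tendsto (fun p => p.1 * p.2) (l ×ˢ pure 0) (𝓝 0) := by
    rw [prod_pure, tendsto_map'_iff]
    simpa [Function.comp_def] using tendsto_const_nhds
  have cm : ContinuousMul (WithZero X) := by
    refine ⟨continuous_iff_continuousAt.2 ?_⟩
    rintro ⟨u, v⟩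
    rw [ContinuousAt, nhds_prod_eq]
    induction u with
    | zero =>
      induction v with
      | zero =>
        rw [mul_zero, n0, sup_prod, prod_sup, prod_sup, ← n0]
        refine Tendsto.sup (Tendsto.sup ?_ ?_) (Tendsto.sup ?_ ?_)
        · exact hzl _
        · exact hzl _
        · exact hzr _
        · rw [prod_map_map_eq, tendsto_map'_iff]
          exact coe_tendsto.comp hmul
      | coe y =>
        rw [zero_mul, n0, nx, sup_prod, ← n0]
        refine Tendsto.sup ?_ ?_
        · exact hzl _
        · rw [prod_pure, tendsto_map'_iff, tendsto_map'_iff]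
          exact coe_tendsto.comp (hr y)
    | coe x =>
      induction v with
      | zero =>
        rw [mul_zero, n0, nx, prod_sup, ← n0]
        refine Tendsto.sup ?_ ?_
        · exact hzr _
        · rw [pure_prod, tendsto_map'_iff, tendsto_map'_iff]
          exact coe_tendsto.comp (hl x)
      | coe y =>
        rw [nx, nx, prod_pure_pure, tendsto_pure_left]
        exact fun s hs => mem_of_mem_nhds hs
  have hc := (hz τ t2 cm).isOpen_compl.mem_nhds (x := 0) (by simp)
  rw [n0] at hc
  have : (∅ : Set X) ∈ F := by
    refine mem_of_superset (mem_map.1 (mem_sup.1 hc).2) fun x hx => ?_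
    simp at hx
  exact empty_notMem F this

/-- If a semigroup of size at most continuum cannot be covered by fewer than continuum many
algebraic sets, then it has a filter as excluded by `ZeroClosed.not_filter`. -/
theorem exists_filter {X : Type u} [Semigroup X] [Nonempty X] (hX : #X ≤ 𝔠)
    (H : ∀ (T : Set (WithOne X)) (B : Set X), #T < 𝔠 → #B < 𝔠 → ∃ x : X, ∀ a : List (WithOne X),
      2 ≤ a.length → (∀ t ∈ a, t ∈ T) → ∀ b ∈ B, polyVal a x ≠ b) :
    ∃ F : Filter X, F.NeBot ∧ (∀ x : X, {x}ᶜ ∈ F) ∧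
      Tendsto (fun p : X × X => p.1 * p.2) (F ×ˢ F) F ∧
      (∀ a : X, Tendsto (a * ·) F F) ∧ (∀ a : X, Tendsto (· * a) F F) := by
  let I : Type u := (Cardinal.continuum.{u}).ord.ToType
  have hIio (i : I) : #(Set.Iio i) < 𝔠 := by
    simpa [I] using Cardinal.mk_Iio_lt i (by simp [I])
  have hIic (i : I) : #(Set.Iic i) < 𝔠 := by
    rw [← Set.Iio_insert]
    exact (Cardinal.mk_insert_le).trans_lt
      (Cardinal.add_lt_of_lt aleph0_le_continuum (hIio i) (one_lt_aleph0.trans aleph0_lt_continuum))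
  have hI : Nonempty I := by
    rw [← Cardinal.mk_ne_zero_iff]
    simpa [I] using Cardinal.continuum_ne_zero
  obtain ⟨y, hy⟩ : ∃ y : I → X, Function.Surjective y := by
    have : #X ≤ #I := by simpa [I] using hX
    obtain ⟨f⟩ := this
    exact ⟨Function.invFun f, Function.invFun_surjective f.injective⟩
  let M (x : I → X) (i : I) : Submonoid (WithOne X) :=
    Submonoid.closure ((↑) '' (y '' Set.Iic i ∪ x '' Set.Iio i))
  have hM (x : I → X) (i : I) : #(M x i) < 𝔠 := by
    have h1 : #((↑) '' (y '' Set.Iic i ∪ x '' Set.Iio i) : Set (WithOne X)) < 𝔠 := by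
      refine mk_image_le.trans_lt ((mk_union_le _ _).trans_lt
        (Cardinal.add_lt_of_lt aleph0_le_continuum ?_ ?_))
      · exact mk_image_le.trans_lt (hIic i)
      · exact mk_image_le.trans_lt (hIio i)
    have h2 : #(M x i) ≤ max ℵ₀ #((↑) '' (y '' Set.Iic i ∪ x '' Set.Iio i) : Set (WithOne X)) := by
      refine le_trans ?_ (mk_list_le_max _)
      have : (M x i : Set (WithOne X)) = _ :=
        congrArg SetLike.coe (Submonoid.closure_eq_mrange _)
      change #(M x i : Set (WithOne X)) ≤ _
      rw [this, MonoidHom.coe_mrange]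
      exact mk_range_le
    exact h2.trans_lt (max_lt aleph0_lt_continuum h1)
  obtain ⟨x, hx⟩ : ∃ x : I → X, ∀ i, ∀ n, ∀ j ≤ i,
      (y j : WithOne X) ∉ PolyValues (M x i) (x i) (n + 1) := by
    choose c hc using H
    let c' (S : Set (WithOne X)) (B : Set X) : X :=
      open Classical in if h : #S < 𝔠 ∧ #B < 𝔠 then c S B h.1 h.2 else Classical.arbitrary X
    have hc' (S : Set (WithOne X)) (B : Set X) (hS : #S < 𝔠) (hB : #B < 𝔠) :
        ∀ a : List (WithOne X), 2 ≤ a.length → (∀ t ∈ a, t ∈ S) → ∀ b ∈ B,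
          polyVal a (c' S B) ≠ b := by
      simpa only [c', hS, hB, and_self, dite_true] using hc S B hS hB
    let W (i : I) (p : ∀ j, j < i → X) : X :=
      c' (Submonoid.closure ((↑) '' (y '' Set.Iic i ∪ {z | ∃ j, ∃ h : j < i, p j h = z})) :
        Submonoid (WithOne X)) (y '' Set.Iic i)
    let x : I → X := (wellFounded_lt (α := I)).fix W
    have hxi (i : I) : x i = c' (M x i) (y '' Set.Iic i) := by
      have := (wellFounded_lt (α := I)).fix_eq W i
      refine this.trans ?_
      have e : {z | ∃ j, ∃ _ : j < i, x j = z} = x '' Set.Iio i := by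
        ext z; simp
      simp only [W, M, ← e, x]
    refine ⟨x, fun i n j hj => ?_⟩
    rintro ⟨a, hal, ha, h⟩
    refine hc' (M x i) (y '' Set.Iic i) (hM x i) (mk_image_le.trans_lt (hIic i)) a (by omega) ha
      (y j) ⟨j, hj, rfl⟩ ?_
    rw [← hxi, h]
  have hMmono {i j : I} (hij : i ≤ j) : M x i ≤ M x j :=
    Submonoid.closure_mono (Set.image_mono (Set.union_subset_union
      (Set.image_mono (Set.Iic_subset_Iic.2 hij)) (Set.image_mono (Set.Iio_subset_Iio hij))))
  have hxM {i j : I} (hij : i < j) : (x i : WithOne X) ∈ M x j :=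
    Submonoid.subset_closure ⟨x i, .inr ⟨i, hij, rfl⟩, rfl⟩
  have hyM {i j : I} (hij : i ≤ j) : (y i : WithOne X) ∈ M x j :=
    Submonoid.subset_closure ⟨y i, .inl ⟨i, hij, rfl⟩, rfl⟩
  let U (i : I) : Set X := {w | ∃ j, i ≤ j ∧ ∃ n, (w : WithOne X) ∈ PolyValues (M x j) (x j) (n + 1)}
  have hU : Antitone U := fun i j hij w ⟨k, hk, h⟩ => ⟨k, hij.trans hk, h⟩
  have hbasis : (⨅ i, 𝓟 (U i)).HasBasis (fun _ => True) U :=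
    hasBasis_iInf_principal hU.directed_ge
  have hUU (i : I) {v w : X} (hv : v ∈ U i) (hw : w ∈ U i) : v * w ∈ U i := by
    obtain ⟨j, hij, m, hv⟩ := hv
    obtain ⟨k, hik, n, hw⟩ := hw
    rcases lt_trichotomy j k with h | rfl | h
    · refine ⟨k, hik, n, ?_⟩
      rw [WithOne.coe_mul, ← zero_add (n + 1)]
      exact mul_mem_polyValues (mem_polyValues_zero
        (PolyValues.mem_of_le (hMmono h.le) (hxM h) hv)) hw
    · refine ⟨j, hij, m + 1 + n, ?_⟩
      rw [WithOne.coe_mul, add_assoc]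
      exact mul_mem_polyValues hv hw
    · refine ⟨j, hij, m, ?_⟩
      rw [WithOne.coe_mul, ← add_zero (m + 1)]
      exact mul_mem_polyValues hv (mem_polyValues_zero
        (PolyValues.mem_of_le (hMmono h.le) (hxM h) hw))
  refine ⟨⨅ i, 𝓟 (U i), ?_, fun z => ?_, ?_, fun a => ?_, fun a => ?_⟩
  · refine hbasis.neBot_iff.2 fun {i} _ => ⟨x i, i, le_rfl, 0, mem_polyValues_one⟩
  · obtain ⟨i, rfl⟩ := hy z
    refine hbasis.mem_iff.2 ⟨i, trivial, fun w hw => ?_⟩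
    rintro rfl
    obtain ⟨j, hij, n, h⟩ := hw
    exact hx j n i hij h
  · refine (hbasis.prod_self.tendsto_iff hbasis).2 fun i _ => ⟨i, trivial, ?_⟩
    rintro ⟨v, w⟩ ⟨hv, hw⟩
    exact hUU i hv hw
  · obtain ⟨k, rfl⟩ := hy a
    refine (hbasis.tendsto_iff hbasis).2 fun i _ => ⟨max i k, trivial, ?_⟩
    rintro w ⟨j, hj, n, hw⟩
    refine ⟨j, (le_max_left _ _).trans hj, n, ?_⟩
    rw [WithOne.coe_mul, ← zero_add (n + 1)]
    exact mul_mem_polyValues (mem_polyValues_zero (hyM ((le_max_right _ _).trans hj))) hw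
  · obtain ⟨k, rfl⟩ := hy a
    refine (hbasis.tendsto_iff hbasis).2 fun i _ => ⟨max i k, trivial, ?_⟩
    rintro w ⟨j, hj, n, hw⟩
    refine ⟨j, (le_max_left _ _).trans hj, n, ?_⟩
    rw [WithOne.coe_mul, ← add_zero (n + 1)]
    exact mul_mem_polyValues hw (mem_polyValues_zero (hyM ((le_max_right _ _).trans hj)))

end Filter

section Cover

open MeasureTheory Filter Topology ProbabilityTheory

/-- The distribution function of a measure sends null sets to null sets. -/
theorem _root_.StieltjesFunction.volume_image_eq_zero (F : StieltjesFunction ℝ) {E : Set ℝ}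
    (hE : F.measure E = 0) : volume (F '' E) = 0 := by
  have h : OuterMeasure.comap F (volume : Measure ℝ).toOuterMeasure ≤ F.outer := by
    refine OuterMeasure.le_ofFunction.2 fun s => ?_
    rw [StieltjesFunction.length_eq, OuterMeasure.comap_apply]
    refine le_iInf₂ fun a b => le_iInf fun hs => ?_
    have : F '' s ⊆ Set.Icc (F a) (F b) := by
      rintro _ ⟨x, hx, rfl⟩
      have := hs ⟨hx, not_isBot x⟩
      exact ⟨F.mono this.1.le, F.mono this.2⟩
    simpa using measure_mono (μ := volume) this
  have h' : F.outer E = 0 := by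
    rw [StieltjesFunction.measure_def] at hE
    exact hE
  exact le_antisymm ((h E).trans h'.le) bot_le

theorem _root_.ProbabilityTheory.continuous_cdf (ν : Measure ℝ) [IsProbabilityMeasure ν]
    [NullSingletonClass ν] : Continuous (cdf ν) := by
  refine continuous_iff_continuousAt.2 fun x => ?_
  refine (monotone_cdf ν).continuousAt_iff_leftLim_eq_rightLim.2 ?_
  rw [(cdf ν).rightLim_eq]
  have h : (cdf ν).measure {x} = 0 := by rw [measure_cdf, measure_singleton]
  rw [StieltjesFunction.measure_singleton, ENNReal.ofReal_eq_zero] at h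
  exact le_antisymm ((monotone_cdf ν).leftLim_le le_rfl) (by linarith)

/-- A closed subset of the real line of full measure for an atomless probability measure `ν`
is mapped by the distribution function of `ν` onto a set containing the open unit interval. -/
theorem Ioo_subset_image_cdf (ν : Measure ℝ) [IsProbabilityMeasure ν]
    [NullSingletonClass ν] {C : Set ℝ} (hC : IsClosed C) (hν : ν Cᶜ = 0) :
    Set.Ioo 0 1 ⊆ cdf ν '' C := by
  rintro c ⟨h0, h1⟩
  have hmono := monotone_cdf ν
  obtain ⟨t, rfl⟩ : c ∈ Set.range (cdf ν) :=
    mem_range_of_exists_le_of_exists_ge (continuous_cdf ν)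
      (((tendsto_cdf_atBot ν).eventually (gt_mem_nhds h0)).exists.imp fun _ => le_of_lt)
      (((tendsto_cdf_atTop ν).eventually (lt_mem_nhds h1)).exists.imp fun _ => le_of_lt)
  have hreal (a : ℝ) (h : Disjoint (Set.Ioc a t) C) : cdf ν a = cdf ν t ∨ t ≤ a := by
    by_cases hat : t ≤ a
    · exact .inr hat
    have : (cdf ν).measure (Set.Ioc a t) = 0 := by
      rw [measure_cdf]
      exact measure_mono_null h.subset_compl_right hν
    rw [StieltjesFunction.measure_Ioc, ENNReal.ofReal_eq_zero] at this
    exact .inl (le_antisymm (hmono (not_le.1 hat).le) (by linarith))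
  have hne : (C ∩ Set.Iic t).Nonempty := by
    by_contra hempty
    rw [Set.not_nonempty_iff_eq_empty, ← Set.disjoint_iff_inter_eq_empty] at hempty
    have : ν (Set.Iic t) = 0 := measure_mono_null hempty.symm.subset_compl_right hν
    rw [← ofReal_cdf, ENNReal.ofReal_eq_zero] at this
    linarith
  have hbdd : BddAbove (C ∩ Set.Iic t) := ⟨t, fun _ h => h.2⟩
  have hs := (hC.inter isClosed_Iic).csSup_mem hne hbdd
  refine ⟨sSup (C ∩ Set.Iic t), hs.1, ?_⟩
  obtain h | h := hreal (sSup (C ∩ Set.Iic t)) (Set.disjoint_left.2 fun u hu huC =>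
    hu.1.not_ge (le_csSup hbdd ⟨huC, hu.2⟩))
  · exact h
  · rw [le_antisymm hs.2 h]

/-- A continuous surjection from a compact set of reals onto a Hausdorff space has a
Borel section. -/
theorem exists_measurable_section {G : Type*} [TopologicalSpace G] [T2Space G] [MeasurableSpace G]
    [BorelSpace G] {C : Set ℝ} (hC : IsCompact C) {θ : C → G} (hθ : Continuous θ)
    (hsurj : Function.Surjective θ) : ∃ s : G → C, Measurable s ∧ ∀ g, θ (s g) = g := by
  have : CompactSpace C := isCompact_iff_compactSpace.1 hC
  have hmin (g : G) : ∃ x : C, θ x = g ∧ ∀ y, θ y = g → x ≤ y := by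
    obtain ⟨x, hx, hmin⟩ := ((isClosed_singleton (x := g)).preimage hθ).isCompact.exists_isLeast
      (hsurj g)
    exact ⟨x, hx, fun y hy => hmin hy⟩
  choose s hs hle using hmin
  refine ⟨s, ?_, hs⟩
  refine (measurable_of_Iic (f := fun g => (s g : ℝ)) fun t => ?_).subtype_mk
  have : (fun g => (s g : ℝ)) ⁻¹' Set.Iic t = θ '' {x | (x : ℝ) ≤ t} := by
    ext g
    constructor
    · intro h
      exact ⟨s g, h, hs g⟩
    · rintro ⟨x, hx, rfl⟩
      exact (Subtype.coe_le_coe.2 (hle _ x rfl)).trans hx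
  rw [this]
  exact ((isClosed_le continuous_subtype_val continuous_const).isCompact.image hθ).isClosed.measurableSet

/-- If `cov(N̄) = 𝔠`, then no compact metrizable space with an atomless Borel probability
measure is covered by fewer than continuum many closed null sets. -/
theorem exists_notMem_closed_null (hcov : covClosedNull = 𝔠) {G : Type*} [TopologicalSpace G]
    [CompactSpace G] [TopologicalSpace.MetrizableSpace G] [MeasurableSpace G] [BorelSpace G]
    (μ : Measure G) [IsProbabilityMeasure μ] [NullSingletonClass μ] {ι : Type u} (hι : #ι < 𝔠)
    (A : ι → Set G) (hA : ∀ i, IsClosed (A i)) (hμ : ∀ i, μ (A i) = 0) : ∃ g, ∀ i, g ∉ A i := by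
  by_contra! hcontra
  have : Nonempty G := nonempty_of_isProbabilityMeasure μ
  obtain ⟨θ, hθ, hsurj⟩ : ∃ θ : cantorSet → G, Continuous θ ∧ Function.Surjective θ := by
    let : MetricSpace G := TopologicalSpace.metrizableSpaceMetric G
    obtain ⟨f, hf, hs⟩ := exists_nat_bool_continuous_surjective_of_compact G
    exact ⟨f ∘ cantorSetHomeomorphNatToBool, by fun_prop,
      hs.comp cantorSetHomeomorphNatToBool.surjective⟩
  obtain ⟨s, hs, hθs⟩ := exists_measurable_section isCompact_cantorSet hθ hsurj
  have hs' : Measurable fun g => (s g : ℝ) := measurable_subtype_coe.comp hs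
  let ν : Measure ℝ := μ.map fun g => (s g : ℝ)
  have : IsProbabilityMeasure ν := Measure.isProbabilityMeasure_map hs'.aemeasurable
  have : NullSingletonClass ν := by
    refine ⟨fun x => ?_⟩
    rw [Measure.map_apply hs' (measurableSet_singleton x)]
    refine Set.Subsingleton.measure_zero (fun g hg h hh => ?_) μ
    rw [← hθs g, ← hθs h, Subtype.ext (Eq.trans hg (Eq.symm hh) : (s g : ℝ) = s h)]
  have hνC : ν cantorSetᶜ = 0 := by
    rw [Measure.map_apply hs' isClosed_cantorSet.isOpen_compl.measurableSet]
    convert measure_empty (μ := μ)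
    ext g
    simp
  let B (i : ι) : Set ℝ := cdf ν '' ((↑) '' (θ ⁻¹' A i))
  have hBc (i : ι) : IsCompact (((↑) : cantorSet → ℝ) '' (θ ⁻¹' A i)) := by
    have : CompactSpace cantorSet := isCompact_iff_compactSpace.1 isCompact_cantorSet
    exact ((hA i).preimage hθ).isCompact.image continuous_subtype_val
  have hB (i : ι) : IsClosed (B i) := ((hBc i).image (continuous_cdf ν)).isClosed
  have hB0 (i : ι) : volume (B i) = 0 := by
    refine (cdf ν).volume_image_eq_zero ?_
    rw [measure_cdf, Measure.map_apply hs' (hBc i).measurableSet]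
    refine measure_mono_null (fun g hg => ?_) (hμ i)
    obtain ⟨x, hx, hxg⟩ := hg
    rwa [← hθs g, ← Subtype.ext hxg]
  have hcover : Set.Ioo 0 1 ⊆ ⋃ i, B i := by
    refine (Ioo_subset_image_cdf ν isClosed_cantorSet hνC).trans ?_
    rintro _ ⟨x, hx, rfl⟩
    obtain ⟨i, hi⟩ := hcontra (θ ⟨x, hx⟩)
    exact Set.mem_iUnion.2 ⟨i, _, ⟨⟨x, hx⟩, hi, rfl⟩, rfl⟩
  let D (p : ℚ × ι) : Set ℝ := (fun x : ℝ => x + p.1) ⁻¹' B p.2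
  have hle : covClosedNull ≤ #(Set.range D) := by
    refine csInf_le' ⟨Set.range D, ?_, ?_, rfl⟩
    · rintro _ ⟨⟨q, i⟩, rfl⟩
      refine ⟨(hB i).preimage (by fun_prop), ?_⟩
      simp only [D, measure_preimage_add_right, hB0]
    · refine Set.eq_univ_of_forall fun x => ?_
      obtain ⟨q, hq, hq'⟩ := exists_rat_btwn (show -x < 1 - x by linarith)
      obtain ⟨i, hi⟩ := Set.mem_iUnion.1 (hcover (a := x + q) ⟨by linarith, by linarith⟩)
      exact ⟨_, ⟨(q, i), rfl⟩, hi⟩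
  rw [hcov] at hle
  have hlt : lift.{u} #(Set.range D) < lift.{u} (𝔠 : Cardinal.{0}) := by
    refine (mk_range_le_lift (f := D)).trans_lt ?_
    simpa using Cardinal.mul_lt_of_lt aleph0_le_continuum aleph0_lt_continuum hι
  exact hle.not_gt (lift_lt.1 hlt)

end Cover

section Group

open MeasureTheory Filter Topology

/-- In a compact topological group, powers of all elements uniformly return to a given
neighborhood of the identity. -/
theorem exists_pow_mem_of_compact {G : Type*} [Group G] [TopologicalSpace G] [CompactSpace G]
    [IsTopologicalGroup G] {W : Set G} (hW : W ∈ 𝓝 1) :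
    ∃ n : ℕ, ∀ g : G, ∃ k, 1 ≤ k ∧ k ≤ n ∧ g ^ k ∈ W := by
  have hrec (g : G) : ∃ k, 1 ≤ k ∧ g ^ k ∈ interior W := by
    obtain ⟨q, hq⟩ := exists_clusterPt_of_compactSpace (map (fun k : ℕ => g ^ k) atTop)
    have hdiv : Tendsto (fun p : G × G => p.1 / p.2) (𝓝 q ×ˢ 𝓝 q) (𝓝 1) := by
      rw [← nhds_prod_eq]
      exact (continuous_fst.div' continuous_snd).tendsto' (q, q) 1 (div_self' q)
    obtain ⟨O, hO, hOW⟩ := mem_prod_self_iff.1 (hdiv (interior_mem_nhds.2 hW))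
    have hf : ∃ᶠ k : ℕ in atTop, g ^ k ∈ O := by
      have := mapClusterPt_iff_frequently.1 hq
      exact this O hO
    obtain ⟨i, -, hi⟩ := frequently_atTop.1 hf 0
    obtain ⟨j, hj, hj'⟩ := frequently_atTop.1 hf (i + 1)
    refine ⟨j - i, by omega, ?_⟩
    have := hOW (Set.mk_mem_prod hj' hi)
    rwa [Set.mem_preimage, ← pow_sub_mul_pow g (show i ≤ j by omega), mul_div_cancel_right] at this
  obtain ⟨t, ht⟩ := isCompact_univ.elim_finite_subcover
    (fun k : ℕ => {g : G | 1 ≤ k ∧ g ^ k ∈ interior W})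
    (fun k => by
      by_cases hk : 1 ≤ k
      · simp only [hk, true_and]
        exact isOpen_interior.preimage (continuous_pow k)
      · simp [hk])
    (fun g _ => Set.mem_iUnion.2 (hrec g))
  refine ⟨t.sup id, fun g => ?_⟩
  obtain ⟨k, hk, h1, h2⟩ := Set.mem_iUnion₂.1 (ht (Set.mem_univ g))
  exact ⟨k, h1, Finset.le_sup (f := id) hk, interior_subset h2⟩

/-- A compact group in which some level set `A` of a nonconstant polynomial has
`A / A ∈ 𝓝 1` is polyfinite in a strong sense. -/
theorem exists_isPolyMap_eq_one {G : Type*} [Group G] [TopologicalSpace G] [CompactSpace G]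
    [IsTopologicalGroup G] {m : ℕ} (hm : 1 ≤ m) {f : G → G} (hf : IsPolyMap m f) (b : G)
    (hb : {g | f g = b} / {g | f g = b} ∈ 𝓝 (1 : G)) :
    ∃ n : ℕ, ∀ x y : G, ∃ k, 1 ≤ k ∧ k ≤ n ∧ ∃ h, IsPolyMap k h ∧ h x = 1 ∧ h y = 1 := by
  have hW : (fun p : G × G => p.1 / p.2) ⁻¹' ({g | f g = b} / {g | f g = b}) ∈ 𝓝 (1 : G × G) := by
    refine (continuous_fst.div' continuous_snd).continuousAt.preimage_mem_nhds ?_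
    simpa using hb
  obtain ⟨n, hn⟩ := exists_pow_mem_of_compact hW
  refine ⟨m * n, fun x y => ?_⟩
  obtain ⟨k, hk, hkn, s, hs, t, ht, hst⟩ := hn (x, y)
  refine ⟨m * k, Nat.mul_pos hm hk, Nat.mul_le_mul_left m hkn, _,
    (hf.comp (.pow_mul k ((x ^ k)⁻¹ * s))).const_mul b⁻¹, ?_, ?_⟩
  · simp only [mul_inv_cancel_left]
    rw [show f s = b from hs, inv_mul_cancel]
  · have : y ^ k * ((x ^ k)⁻¹ * s) = t := by
      have h : s / t = x ^ k / y ^ k := hst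
      rw [← mul_assoc, ← div_eq_mul_inv, ← inv_div, ← h, inv_div, div_mul_cancel]
    simp only [this]
    rw [show f t = b from ht, inv_mul_cancel]

/-- Under `cov(N̄) = 𝔠`, if all algebraic sets in the compact group `G ⊆ X` were thin,
then `X` would carry a filter as excluded by `ZeroClosed.not_filter`. -/
theorem exists_level_set_div_mem_nhds (hcov : covClosedNull = 𝔠) {X : Type u} [Semigroup X]
    (hX : #X ≤ 𝔠)
    (hfilter : ¬ ∃ F : Filter X, F.NeBot ∧ (∀ x : X, {x}ᶜ ∈ F) ∧
      Tendsto (fun p : X × X => p.1 * p.2) (F ×ˢ F) F ∧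
      (∀ a : X, Tendsto (a * ·) F F) ∧ (∀ a : X, Tendsto (· * a) F F))
    {G : Type*} [Group G] [TopologicalSpace G] [CompactSpace G] [IsTopologicalGroup G]
    [TopologicalSpace.MetrizableSpace G]
    (ι : G →ₙ* X) (ρ : X → G) (hρ : ∀ x, ι (ρ x) = ι 1 * x * ι 1) (hι : Function.Injective ι) :
    ∃ m, 1 ≤ m ∧ ∃ f : G → G, IsPolyMap m f ∧ ∃ b, {g | f g = b} / {g | f g = b} ∈ 𝓝 (1 : G) := by
  by_cases hdisc : (𝓝[≠] (1 : G)).NeBot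
  swap
  · refine ⟨1, le_rfl, _, .step 1 (.const 1), 1, ?_⟩
    rw [not_neBot, ← isOpen_singleton_iff_punctured_nhds] at hdisc
    simpa using hdisc.mem_nhds rfl
  by_contra! hcontra
  borelize G
  let μ : Measure G := Measure.haarMeasure ⊤
  have : IsProbabilityMeasure μ :=
    ⟨by simpa using Measure.haarMeasure_self (K₀ := (⊤ : TopologicalSpace.PositiveCompacts G))⟩
  have hnull (m : ℕ) (hm : 1 ≤ m) (f : G → G) (hf : IsPolyMap m f) (b : G) :
      IsClosed {g | f g = b} ∧ μ {g | f g = b} = 0 := by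
    have hc : IsClosed {g | f g = b} := isClosed_eq hf.continuous continuous_const
    refine ⟨hc, ?_⟩
    by_contra hpos
    exact hcontra m hm f hf b
      (Measure.div_mem_nhds_one_of_haar_pos μ _ hc.measurableSet (pos_iff_ne_zero.2 hpos))
  have : Nonempty X := ⟨ι 1⟩
  refine hfilter (exists_filter hX fun T B hT hB => ?_)
  let J := {a : List T // 2 ≤ a.length} × B
  have hJ : #J < 𝔠 := by
    rw [mk_prod, lift_id, lift_id]
    refine Cardinal.mul_lt_of_lt aleph0_le_continuum ((mk_subtype_le _).trans_lt ?_) hB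
    exact (mk_list_le_max _).trans_lt (max_lt aleph0_lt_continuum hT)
  choose f hf hval using fun j : J => exists_isPolyMap_of_polyVal ι ρ hρ (j.1.1.map (↑)) (by
    intro h
    have h1 := congrArg List.length h
    have h2 := j.1.2
    simp at h1
    simp [h1] at h2)
  have hdeg (j : J) : 1 ≤ (j.1.1.map ((↑) : T → WithOne X)).length - 1 := by
    have := j.1.2
    simp
    omega
  obtain ⟨g, hg⟩ := exists_notMem_closed_null hcov μ hJ (fun j => {g | f j g = ρ j.2})
    (fun j => (hnull _ (hdeg j) _ (hf j) _).1) (fun j => (hnull _ (hdeg j) _ (hf j) _).2)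
  refine ⟨ι g, fun a ha haT b hb h => ?_⟩
  lift a to List T using haT
  refine hg (⟨a, by simpa using ha⟩, ⟨b, hb⟩) (hι (WithOne.coe_inj.1 ?_))
  rw [hval, h, hρ]
  rfl

end Group

section Corner

open Topology

/-- A compact semigroup contains an idempotent `e` such that every element of `eXe` is
left invertible. -/
theorem exists_minimal_idempotent (X : Type*) [Semigroup X] [Nonempty X] [TopologicalSpace X]
    [CompactSpace X] [T2Space X] [ContinuousMul X] :
    ∃ e : X, e * e = e ∧ ∀ x, ∃ z, z * (e * x * e) = e := by
  obtain ⟨L, -, hL⟩ := zorn_superset_nonempty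
    {L : Set X | IsClosed L ∧ L.Nonempty ∧ ∀ a, ∀ x ∈ L, a * x ∈ L} (fun c hc hchain hne => by
      refine ⟨⋂₀ c, ⟨isClosed_sInter fun s hs => (hc hs).1, ?_, fun a x hx s hs =>
        (hc hs).2.2 a x (hx s hs)⟩, fun s hs => Set.sInter_subset_of_mem hs⟩
      have : Nonempty c := hne.to_subtype
      exact IsCompact.nonempty_sInter_of_directed_nonempty_isCompact_isClosed
        (fun s hs t ht => (hchain.total hs ht).elim (fun h => ⟨s, hs, subset_rfl, h⟩)
          (fun h => ⟨t, ht, h, subset_rfl⟩))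
        (fun s hs => (hc hs).2.1) (fun s hs => (hc hs).1.isCompact)
        (fun s hs => (hc hs).1)) Set.univ ⟨isClosed_univ, Set.univ_nonempty, fun _ _ _ => trivial⟩
  obtain ⟨hLc, hLne, hLi⟩ := hL.prop
  obtain ⟨e, heL, he⟩ := exists_idempotent_in_compact_subsemigroup
    (fun r => continuous_mul_const r) L hLne hLc.isCompact (fun x _ y hy => hLi x y hy)
  refine ⟨e, he, fun x => ?_⟩
  have hy : e * x * e ∈ L := hLi _ _ heL
  have hmem : Set.range (· * (e * x * e)) ∈
      {L : Set X | IsClosed L ∧ L.Nonempty ∧ ∀ a, ∀ x ∈ L, a * x ∈ L} := by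
    refine ⟨(isCompact_range (continuous_mul_const _)).isClosed, Set.range_nonempty _, ?_⟩
    rintro a _ ⟨z, rfl⟩
    exact ⟨a * z, mul_assoc _ _ _⟩
  have hsub : Set.range (· * (e * x * e)) ⊆ L := by
    rintro _ ⟨z, rfl⟩
    exact hLi z _ hy
  exact hL.le_of_le hmem hsub heL

/-- The inversion of a compact Hausdorff group with continuous multiplication is continuous. -/
theorem isTopologicalGroup_of_compact (G : Type*) [Group G] [TopologicalSpace G] [CompactSpace G]
    [T2Space G] [ContinuousMul G] : IsTopologicalGroup G where
  continuous_inv := by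
    refine continuous_iff_isClosed.2 fun s hs => ?_
    have : (·⁻¹ : G → G) ⁻¹' s = Prod.fst '' ({p : G × G | p.1 * p.2 = 1} ∩ Prod.snd ⁻¹' s) := by
      ext x
      constructor
      · intro hx
        exact ⟨(x, x⁻¹), ⟨mul_inv_cancel x, hx⟩, rfl⟩
      · rintro ⟨⟨x, y⟩, ⟨h, hy⟩, rfl⟩
        rw [Set.mem_preimage, inv_eq_of_mul_eq_one_right h]
        exact hy
    rw [this]
    exact (((isClosed_eq (by fun_prop) continuous_const).inter
      (hs.preimage continuous_snd)).isCompact.image continuous_fst).isClosed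

/-- The subsemigroup `eXe` of a compact semigroup is a compact group if all its elements are
left invertible. -/
theorem exists_corner_group {X : Type u} [Semigroup X] [TopologicalSpace X]
    [CompactSpace X] [T2Space X] [ContinuousMul X] {e : X} (he : e * e = e)
    (hinv : ∀ x, ∃ z, z * (e * x * e) = e) :
    ∃ (G : Type u) (_ : Group G) (_ : TopologicalSpace G) (ι : G →ₙ* X) (ρ : X → G),
      CompactSpace G ∧ IsTopologicalGroup G ∧ IsEmbedding ι ∧ ι 1 = e ∧
        ∀ x, ι (ρ x) = e * x * e := by
  let G := {x : X // e * x = x ∧ x * e = x}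
  let ρ (x : X) : G := ⟨e * x * e, by simp only [← mul_assoc, he], by simp only [mul_assoc, he]⟩
  let : Mul G := ⟨fun x y => ⟨x.1 * y.1, by rw [← mul_assoc, x.2.1], by rw [mul_assoc, y.2.2]⟩⟩
  have hmul (x y : G) : (x * y).1 = x.1 * y.1 := rfl
  have hρ (x : G) : e * x.1 * e = x.1 := by rw [x.2.1, x.2.2]
  choose z hz using hinv
  let : One G := ⟨⟨e, he, he⟩⟩
  have hone : (1 : G).1 = e := rfl
  let : Inv G := ⟨fun x => ρ (z x.1)⟩
  let : Group G := Group.ofLeftAxioms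
    (fun x y w => Subtype.ext (mul_assoc _ _ _))
    (fun x => Subtype.ext x.2.1)
    (fun x => Subtype.ext (by
      change e * z x.1 * e * x.1 = e
      have := hz x.1
      rw [hρ] at this
      rw [mul_assoc, x.2.1, mul_assoc, this, he]))
  let ι : G →ₙ* X := ⟨Subtype.val, hmul⟩
  have : CompactSpace G := isCompact_iff_compactSpace.1
    ((isClosed_eq (f := (e * ·)) (by fun_prop) continuous_id).inter
      (isClosed_eq (f := (· * e)) (by fun_prop) continuous_id)).isCompact
  have : ContinuousMul G :=
    ⟨((continuous_subtype_val.comp continuous_fst).mul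
      (continuous_subtype_val.comp continuous_snd)).subtype_mk _⟩
  exact ⟨G, inferInstance, inferInstance, ι, ρ, inferInstance, isTopologicalGroup_of_compact G,
    .subtypeVal, rfl, fun _ => rfl⟩

end Corner

section Quotient

open Filter Topology

/-- The filters on `X` whose absence characterises zero-closedness are reflected by surjective
homomorphisms. -/
theorem ZeroClosed.not_exists_filter_of_surjective {X Y : Type*} [Semigroup X] [Semigroup Y]
    (hz : ZeroClosed X) (π : X →ₙ* Y) (hπ : Function.Surjective π) :
    ¬ ∃ F : Filter Y, F.NeBot ∧ (∀ y : Y, {y}ᶜ ∈ F) ∧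
      Tendsto (fun p : Y × Y => p.1 * p.2) (F ×ˢ F) F ∧
      (∀ a : Y, Tendsto (a * ·) F F) ∧ (∀ a : Y, Tendsto (· * a) F F) := by
  rintro ⟨F, hF, hfree, hmul, hl, hr⟩
  have : (comap π F).NeBot := hF.comap_of_surj hπ
  refine hz.not_filter (comap π F) (fun x => ?_) ?_ (fun a => ?_) (fun a => ?_)
  · refine mem_of_superset (preimage_mem_comap (hfree (π x))) fun y hy hyx => hy ?_
    rw [Set.mem_singleton_iff.1 hyx]
    rfl
  · refine tendsto_comap_iff.2 ?_
    have := hmul.comp ((tendsto_comap (f := π) (x := F)).prodMap (tendsto_comap (f := π) (x := F)))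
    refine this.congr fun p => ?_
    simp
  · refine tendsto_comap_iff.2 (((hl (π a)).comp tendsto_comap).congr fun x => ?_)
    simp
  · refine tendsto_comap_iff.2 (((hr (π a)).comp tendsto_comap).congr fun x => ?_)
    simp

/-- A compact metrizable space has at most continuum many points. -/
theorem mk_le_continuum_of_compact (Y : Type u) [TopologicalSpace Y] [CompactSpace Y]
    [TopologicalSpace.MetrizableSpace Y] : #Y ≤ 𝔠 := by
  cases isEmpty_or_nonempty Y
  · simp
  let := TopologicalSpace.metrizableSpaceMetric Y
  obtain ⟨f, -, hf⟩ := exists_nat_bool_continuous_surjective_of_compact Y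
  simpa using Cardinal.mk_le_of_surjective (f := fun x : ULift.{u} (ℕ → Bool) => f x.down)
    fun y => (hf y).elim fun x hx => ⟨⟨x⟩, hx⟩

/-- In a compact metrizable semigroup without the filters excluded by zero-closedness, any two
points are sent to a minimal idempotent by a common nonconstant polynomial of bounded degree. -/
theorem exists_isPolyMap_eq_of_metrizable (hcov : covClosedNull = 𝔠) {Y : Type u} [Semigroup Y]
    [TopologicalSpace Y] [CompactSpace Y] [ContinuousMul Y] [TopologicalSpace.MetrizableSpace Y]
    (hfilter : ¬ ∃ F : Filter Y, F.NeBot ∧ (∀ y : Y, {y}ᶜ ∈ F) ∧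
      Tendsto (fun p : Y × Y => p.1 * p.2) (F ×ˢ F) F ∧
      (∀ a : Y, Tendsto (a * ·) F F) ∧ (∀ a : Y, Tendsto (· * a) F F))
    {e : Y} (he : e * e = e) (hinv : ∀ x, ∃ z, z * (e * x * e) = e) :
    ∃ n : ℕ, ∀ x y : Y, ∃ k, 1 ≤ k ∧ k ≤ n ∧ ∃ h, IsPolyMap k h ∧ h x = e ∧ h y = e := by
  obtain ⟨G, _, _, ι, ρ, _, _, hι, hι1, hρ⟩ := exists_corner_group he hinv
  have : TopologicalSpace.MetrizableSpace G := hι.metrizableSpace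
  obtain ⟨m, hm, f, hf, b, hb⟩ := exists_level_set_div_mem_nhds hcov
    (mk_le_continuum_of_compact Y) hfilter ι ρ (by simpa only [hι1] using hρ) hι.injective
  obtain ⟨n, hn⟩ := exists_isPolyMap_eq_one hm hf b hb
  refine ⟨n, fun x y => ?_⟩
  obtain ⟨k, hk, hkn, h, hh, hx, hy⟩ := hn (ρ x) (ρ y)
  obtain ⟨g, hg, hgh⟩ := hh.exists_extend ι
  refine ⟨k, hk, hkn, fun x => g (e * (x * e)), ?_, ?_, ?_⟩
  · simpa using hg.comp (.step e (.const e))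
  · simp only
    rw [← mul_assoc, ← hρ, hgh, hx, hι1]
  · simp only
    rw [← mul_assoc, ← hρ, hgh, hy, hι1]

/-- Countably many continuous functions on a compact semigroup `X` determine a metrizable
quotient semigroup, in which identified elements cannot be distinguished by these functions
after two-sided translations. -/
theorem exists_metrizable_quotient {X : Type u} [Semigroup X] [TopologicalSpace X]
    [CompactSpace X] [ContinuousMul X] (g : ℕ → C(X, ℝ)) :
    ∃ (Y : Type u) (_ : Semigroup Y) (_ : TopologicalSpace Y) (π : X →ₙ* Y),
      CompactSpace Y ∧ ContinuousMul Y ∧ TopologicalSpace.MetrizableSpace Y ∧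
      Function.Surjective π ∧ ∀ x y, π x = π y → ∀ n a b, g n (a * x * b) = g n (a * y * b) := by
  let c : Con X :=
    { r := fun x y => ∀ n a b, g n (a * x * b) = g n (a * y * b)
      iseqv := ⟨fun _ _ _ _ => rfl, fun h n a b => (h n a b).symm,
        fun h h' n a b => (h n a b).trans (h' n a b)⟩
      mul' := fun {w x y z} h h' n a b => by
        have h1 := h n a (y * b)
        have h2 := h' n (a * x) b
        simp only [← mul_assoc] at h1 h2 ⊢
        rw [h1, h2] }
  let : TopologicalSpace c.Quotient := inferInstanceAs (TopologicalSpace (Quotient c.toSetoid))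
  have : CompactSpace c.Quotient := inferInstanceAs (CompactSpace (Quotient c.toSetoid))
  have hπ : Continuous ((↑) : X → c.Quotient) := continuous_quotient_mk'
  have hsurj : Function.Surjective ((↑) : X → c.Quotient) := Quotient.mk_surjective
  let Φ (x : X) (n : ℕ) : C(X × X, ℝ) :=
    ContinuousMap.curry ⟨fun p : X × X × X => g n (p.2.1 * p.1 * p.2.2), by fun_prop⟩ x
  have hΦ : Continuous Φ := continuous_pi fun n => ContinuousMap.continuous _
  have hΦr (x y : X) : Φ x = Φ y ↔ c x y := by
    constructor
    · intro h n a b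
      exact DFunLike.congr_fun (congrFun h n) (a, b)
    · intro h
      funext n
      ext ⟨a, b⟩
      exact h n a b
  let Ψ : c.Quotient → ℕ → C(X × X, ℝ) := Quotient.lift Φ fun x y h => (hΦr x y).2 h
  have hΨ : Continuous Ψ := hΦ.quotient_lift _
  have hinj : Function.Injective Ψ := by
    intro x y h
    obtain ⟨x, rfl⟩ := hsurj x
    obtain ⟨y, rfl⟩ := hsurj y
    exact c.eq.2 ((hΦr x y).1 h)
  have hemb : IsEmbedding Ψ := (hΨ.isClosedEmbedding hinj).isEmbedding
  have : TopologicalSpace.MetrizableSpace c.Quotient := hemb.metrizableSpace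
  have hquot : IsQuotientMap (Prod.map ((↑) : X → c.Quotient) ((↑) : X → c.Quotient)) :=
    (hπ.prodMap hπ).isClosedMap.isQuotientMap (hπ.prodMap hπ) (hsurj.prodMap hsurj)
  have : ContinuousMul c.Quotient := ⟨by
    rw [hquot.continuous_iff]
    exact hπ.comp continuous_mul⟩
  exact ⟨c.Quotient, inferInstance, inferInstance, ⟨(↑), fun _ _ => rfl⟩, inferInstance,
    inferInstance, inferInstance, hsurj, fun x y h => c.eq.1 h⟩

/-- In a compact zero-closed semigroup, any two points are sent to a minimal idempotent by a
common nonconstant polynomial of bounded degree. -/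
theorem ZeroClosed.exists_isPolyMap_eq {X : Type u} [Semigroup X] [TopologicalSpace X]
    [CompactSpace X] [T2Space X] [ContinuousMul X] (hz : ZeroClosed X)
    (hcov : covClosedNull = 𝔠) {e : X} (he : e * e = e) (hinv : ∀ x, ∃ z, z * (e * x * e) = e) :
    ∃ n : ℕ, ∀ x y : X, ∃ k, 1 ≤ k ∧ k ≤ n ∧ ∃ h, IsPolyMap k h ∧ h x = e ∧ h y = e := by
  by_contra! hcontra
  choose x y hxy using hcontra
  let K (n : ℕ) : Set (X × X) :=
    ⋃ k ∈ Finset.Icc 1 n, {p | ∃ f, IsPolyMap k f ∧ p = (f (x n), f (y n))}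
  have hK (n : ℕ) : IsClosed (K n) :=
    ((Finset.Icc 1 n).isCompact_biUnion fun k _ => IsPolyMap.isCompact_values _ _ k).isClosed
  have heK (n : ℕ) : (e, e) ∉ K n := by
    simp only [K, Set.mem_iUnion, Finset.mem_Icc, Set.mem_ofPred_eq, Prod.mk.injEq, not_exists,
      not_and]
    intro k hk f hf h1 h2
    exact hxy n k hk.1 hk.2 f hf h1.symm h2.symm
  have hg (n : ℕ) : ∃ g : C(X, ℝ), g e = 0 ∧ ∀ p ∈ K n, g p.1 = 1 ∨ g p.2 = 1 := by
    have hnhds : (K n)ᶜ ∈ 𝓝 e ×ˢ 𝓝 e := by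
      rw [← nhds_prod_eq]
      exact (hK n).isOpen_compl.mem_nhds (heK n)
    obtain ⟨U, hU, hUK⟩ := mem_prod_self_iff.1 hnhds
    obtain ⟨g, hg0, hg1, -⟩ := exists_continuous_zero_one_of_isClosed
      (isClosed_singleton (x := e)) (isOpen_interior (s := U)).isClosed_compl
      (Set.disjoint_compl_right_iff_subset.2
        (Set.singleton_subset_iff.2 (mem_interior_iff_mem_nhds.2 hU)))
    refine ⟨g, hg0 rfl, fun p hp => ?_⟩
    by_contra! hne
    refine hUK (Set.mem_prod.2 ⟨?_, ?_⟩ : p ∈ U ×ˢ U) hp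
    · exact interior_subset (not_not.1 fun h => hne.1 (hg1 h))
    · exact interior_subset (not_not.1 fun h => hne.2 (hg1 h))
  choose g hge hgK using hg
  obtain ⟨Y, _, _, π, _, _, _, hπ, hπg⟩ := exists_metrizable_quotient g
  obtain ⟨n, hn⟩ := exists_isPolyMap_eq_of_metrizable hcov
    (hz.not_exists_filter_of_surjective π hπ) (e := π e) (by rw [← map_mul, he]) (fun y => by
      obtain ⟨y, rfl⟩ := hπ y
      obtain ⟨z, hz⟩ := hinv y
      exact ⟨π z, by rw [← map_mul, ← map_mul, ← map_mul, hz]⟩)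
  obtain ⟨k, hk, hkn, h, hh, hx, hy⟩ := hn (π (x n)) (π (y n))
  obtain ⟨f, hf, hfh⟩ := hh.exists_lift π hπ
  have hzero (u : X) (hu : π (f u) = π e) : g n (e * f u * e) = 0 := by
    rw [hπg _ _ hu n e e, he, he, hge]
  have hmem : (e * f (x n) * e, e * f (y n) * e) ∈ K n :=
    Set.mem_biUnion (x := k) (Finset.mem_coe.2 (Finset.mem_Icc.2 ⟨hk, hkn⟩))
      ⟨_, (hf.const_mul e).mul_const e, rfl⟩
  have h1 := hzero (x n) (by rw [hfh, hx])
  have h2 := hzero (y n) (by rw [hfh, hy])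
  obtain h | h := hgK n _ hmem
  · exact zero_ne_one (h1.symm.trans h)
  · exact zero_ne_one (h2.symm.trans h)

end Quotient

/-- Under `cov(N̄) = 𝔠`, every zero-closed semigroup admitting a compact
Hausdorff semigroup topology is polyfinite. -/
theorem statement5 {X : Type u} [Semigroup X] (hz : ZeroClosed X)
    (htop : ∃ τ : TopologicalSpace X,
      @CompactSpace X τ ∧ @T2Space X τ ∧ @ContinuousMul X τ _)
    (hcov : covClosedNull = Cardinal.continuum) :
    Polyfinite X := by
  obtain ⟨τ, _, _, _⟩ := htop
  cases isEmpty_or_nonempty X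
  · exact ⟨0, ∅, Set.finite_empty, fun x => isEmptyElim x⟩
  obtain ⟨e, he, hinv⟩ := exists_minimal_idempotent X
  obtain ⟨n, hn⟩ := hz.exists_isPolyMap_eq hcov he hinv
  refine ⟨n, {e}, Set.finite_singleton e, fun x y => ?_⟩
  obtain ⟨k, hk, hkn, f, hf, hx, hy⟩ := hn x y
  obtain ⟨a, ha, hval⟩ := hf.exists_polyVal
  exact ⟨a, by omega, by omega, ⟨e, rfl, by rw [hval, hx]⟩, ⟨e, rfl, by rw [hval, hy]⟩⟩

end ZeroClosedPaper
end

section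
/- For any infinite set X, the group FS_X of all finitely supported permutations of X (all bijections π : X → X such that the set {x ∈ X : π(x) ≠ x} is finite, with composition as operation) is polyfinite but is not polybounded. -/
open Cardinal Pointwise

universe u

namespace ZeroClosedPaper

/-- A finitely supported permutation is conjugate to its inverse by a finitely supported
permutation. -/
theorem exists_finite_support_conj_eq_inv {X : Type*} (t : Equiv.Perm X)
    (ht : {x : X | t x ≠ x}.Finite) :
    ∃ g : Equiv.Perm X, {x : X | g x ≠ x}.Finite ∧ g * t * g⁻¹ = t⁻¹ := by
  classical
  set s : Set X := {x : X | t x ≠ x} with hs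
  have : Fintype s := ht.fintype
  have hmem : ∀ x, t x ∈ s ↔ x ∈ s := fun x => by simp [hs]
  let r : Equiv.Perm s := t.subtypePerm hmem
  have hr : Equiv.Perm.ofSubtype r = t := Equiv.Perm.ofSubtype_subtypePerm hmem fun _ hx => hx
  have hconj : IsConj r r⁻¹ := by
    rw [Equiv.Perm.isConj_iff_cycleType_eq, Equiv.Perm.cycleType_inv]
  obtain ⟨c, hc⟩ := isConj_iff.1 hconj
  refine ⟨Equiv.Perm.ofSubtype c, ht.subset fun x hx => ?_, ?_⟩
  · by_contra hxs
    exact hx (Equiv.Perm.ofSubtype_apply_of_not_mem c hxs)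
  · have hmap := congrArg Equiv.Perm.ofSubtype hc
    rwa [map_mul, map_mul, map_inv, map_inv, hr] at hmap

/-- In a group where every element is conjugate to its inverse, any two elements are sent to `1`
by a common semigroup polynomial of degree two. -/
theorem polyfinite_of_conj_inv {H : Type*} [Group H]
    (h : ∀ t : H, ∃ g : H, g * t * g⁻¹ = t⁻¹) : Polyfinite H := by
  refine ⟨2, {1}, Set.finite_singleton 1, fun x y => ?_⟩
  obtain ⟨g, hg⟩ := h (y * x⁻¹)
  refine ⟨[1, ((x⁻¹ * g : H) : WithOne H), ((x⁻¹ * g⁻¹ : H) : WithOne H)], by simp, by simp,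
    ⟨1, rfl, ?_⟩, ⟨1, rfl, ?_⟩⟩
  · simp only [polyVal, List.map_cons, List.map_nil, List.prod_cons, List.prod_nil, one_mul,
      mul_one, ← WithOne.coe_mul]
    congr 1
    group
  · simp only [polyVal, List.map_cons, List.map_nil, List.prod_cons, List.prod_nil, one_mul,
      mul_one, ← WithOne.coe_mul]
    congr 1
    calc y * (x⁻¹ * g) * (y * (x⁻¹ * g⁻¹)) = (y * x⁻¹) * (g * (y * x⁻¹) * g⁻¹) := by group
      _ = 1 := by rw [hg, mul_inv_cancel]

/-- If the coefficients of a polynomial fix every point `s i`, while `x` sends `s i` to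
`s (i + 1)`, then the value of the polynomial at `x` shifts the index by the degree. -/
theorem polyVal_apply_of_shift {X R H : Type*} [AddMonoidWithOne R] [Semigroup H]
    (φ : WithOne H →* Equiv.Perm X) (s : R → X) (x : H)
    (hx : ∀ i, φ x (s i) = s (i + 1)) (a : List (WithOne H))
    (ha : ∀ c ∈ a, ∀ i, φ c (s i) = s i) :
    φ (polyVal a x) (s 0) = s ((a.length - 1 : ℕ) : R) := by
  cases a with
  | nil => simp [polyVal]
  | cons a₀ l =>
    have hl : φ ((l.map fun c => (x : WithOne H) * c).prod) (s 0) = s (l.length : R) := by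
      have hl' : ∀ c ∈ l, ∀ i, φ c (s i) = s i := fun c hc => ha c (List.mem_cons_of_mem _ hc)
      clear ha
      induction l with
      | nil => simp
      | cons c l ih =>
        have ih' := ih fun d hd => hl' d (List.mem_cons_of_mem _ hd)
        rw [List.map_cons, List.prod_cons, map_mul, map_mul, Equiv.Perm.mul_apply,
          Equiv.Perm.mul_apply, ih', hl' c List.mem_cons_self, hx, List.length_cons,
          Nat.cast_succ]
    simp only [polyVal, map_mul, Equiv.Perm.mul_apply, hl, List.length_cons,
      Nat.add_sub_cancel]
    exact ha a₀ List.mem_cons_self _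

/-- For any infinite set `X`, the group of finitely supported
permutations of `X` is polyfinite but not polybounded. -/
theorem statement9 {X : Type u} [Infinite X] (G : Subgroup (Equiv.Perm X))
    (hG : (G : Set (Equiv.Perm X)) = {p : Equiv.Perm X | {x : X | p x ≠ x}.Finite}) :
    Polyfinite ↥G ∧ ¬ Polybounded ↥G := by
  have hmem : ∀ p : Equiv.Perm X, p ∈ G ↔ {x : X | p x ≠ x}.Finite := fun p => by
    rw [← SetLike.mem_coe, hG, Set.mem_ofPred_eq]
  constructor
  · refine polyfinite_of_conj_inv fun t => ?_
    obtain ⟨g, hg, hgt⟩ := exists_finite_support_conj_eq_inv (t : Equiv.Perm X) ((hmem _).1 t.2)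
    exact ⟨⟨g, (hmem g).2 hg⟩, Subtype.ext hgt⟩
  · rintro ⟨C, hfin, hC, hcov⟩
    choose! a b hlen hA using hC
    let φ : WithOne G →* Equiv.Perm X := WithOne.lift G.subtype.toMulHom
    have hφ : ∀ p : G, φ p = p := fun p => WithOne.lift_coe _ _
    have hsupp : ∀ c : WithOne G, {x : X | φ c x ≠ x}.Finite := fun c => by
      refine WithOne.cases_on c (by simp) fun p => ?_
      rw [hφ]
      exact (hmem _).1 p.2
    let T : Set X := ⋃ A ∈ C, ({x | φ (b A) x ≠ x} ∪ ⋃ c ∈ {c | c ∈ a A}, {x | φ c x ≠ x})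
    have hT : T.Finite := hfin.biUnion fun A _ =>
      (hsupp _).union ((List.finite_toSet (a A)).biUnion fun c _ => hsupp c)
    obtain ⟨N, hN⟩ := (hfin.image fun A => (a A).length).bddAbove
    have : Infinite ↥(Tᶜ) := hT.infinite_compl.to_subtype
    let s : ZMod (N + 1) ↪ X :=
      (⟨ZMod.val, ZMod.val_injective _⟩ : ZMod (N + 1) ↪ ℕ).trans
        ((Infinite.natEmbedding ↥(Tᶜ)).trans (Function.Embedding.subtype _))
    have hsT : ∀ i, s i ∉ T := fun i => (Infinite.natEmbedding ↥(Tᶜ) (ZMod.val i)).2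
    let σ : Equiv.Perm X := (Equiv.addRight (1 : ZMod (N + 1))).viaEmbedding s
    have hσ : σ ∈ G := (hmem σ).2 <| (Set.finite_range s).subset fun x hx => by
      by_contra hxs
      exact hx (Equiv.Perm.viaEmbedding_apply_of_notMem _ s x hxs)
    obtain ⟨A, hAC, hσA⟩ := hcov (Set.mem_univ (⟨σ, hσ⟩ : G))
    rw [hA A hAC, Set.mem_ofPred_eq] at hσA
    have hfix : ∀ c, (c = (b A : WithOne G) ∨ c ∈ a A) → ∀ i, φ c (s i) = s i := by
      intro c hc i
      by_contra hne
      refine hsT i (Set.mem_biUnion hAC ?_)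
      rcases hc with rfl | hc
      · exact Or.inl hne
      · exact Or.inr (Set.mem_biUnion (show c ∈ {c | c ∈ a A} from hc) hne)
    have hshift := polyVal_apply_of_shift φ s ⟨σ, hσ⟩
      (fun i => by rw [hφ]; exact Equiv.Perm.viaEmbedding_apply _ s i) (a A)
      fun c hc => hfix c (Or.inr hc)
    rw [hσA, hfix _ (Or.inl rfl)] at hshift
    have hdvd := (ZMod.natCast_eq_zero_iff _ _).1 (s.injective hshift).symm
    have h2 := hlen A hAC
    have hle : (a A).length ≤ N := hN ⟨A, hAC, rfl⟩
    have := Nat.le_of_dvd (by omega) hdvd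
    omega

end ZeroClosedPaper
end

section
/- Let h : X → Y be a surjective homomorphism of semigroups. If the semigroup X is zero-closed, then the semigroup Y is zero-closed. -/
open Cardinal Pointwise

universe u

namespace ZeroClosedPaper

/-- The extension `X⁰ → Y⁰` of a semigroup homomorphism sending `0` to `0`. -/
def zeroExtend {X Y : Type*} [Semigroup X] [Semigroup Y] (h : X →ₙ* Y) :
    WithZero X →ₙ* WithZero Y where
  toFun := Option.map h
  map_mul' a b := by
    cases a with
    | zero => rfl
    | coe a =>
      cases b with
      | zero => rfl
      | coe b => exact congrArg ((↑) : Y → WithZero Y) (map_mul h a b)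

theorem zeroExtend_zero {X Y : Type*} [Semigroup X] [Semigroup Y] (h : X →ₙ* Y) :
    zeroExtend h 0 = 0 := rfl

theorem zeroExtend_coe {X Y : Type*} [Semigroup X] [Semigroup Y] (h : X →ₙ* Y) (x : X) :
    zeroExtend h x = (h x : WithZero Y) := rfl

theorem zeroExtend_surjective {X Y : Type*} [Semigroup X] [Semigroup Y] {h : X →ₙ* Y}
    (hsurj : Function.Surjective h) : Function.Surjective (zeroExtend h) := by
  intro b
  cases b with
  | zero => exact ⟨0, rfl⟩
  | coe y =>
    obtain ⟨x, rfl⟩ := hsurj y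
    exact ⟨x, rfl⟩

theorem range_coe_eq_compl_zero (X : Type*) :
    Set.range ((↑) : X → WithZero X) = {0}ᶜ := by
  ext a
  cases a <;> simp

open Filter Topology in
/-- A semigroup topology on `Y⁰` pulls back to the topology on `X⁰` in which the points of `X`
are isolated and the neighborhoods of `0` are the preimages of those in `Y⁰`. -/
theorem continuousMul_nhdsAdjoint_comap {X Y : Type*} [Semigroup X] [Semigroup Y] (h : X →ₙ* Y)
    [TopologicalSpace (WithZero Y)] [ContinuousMul (WithZero Y)] :
    @ContinuousMul (WithZero X) (nhdsAdjoint 0 (comap (zeroExtend h) (𝓝 0))) _ := by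
  let _ : TopologicalSpace (WithZero X) := nhdsAdjoint 0 (comap (zeroExtend h) (𝓝 0))
  have nhds_zero : 𝓝 (0 : WithZero X) = comap (zeroExtend h) (𝓝 0) := by
    refine (nhds_nhdsAdjoint_same _ _).trans (sup_eq_right.2 ?_)
    rw [← map_le_iff_le_comap, Filter.map_pure, zeroExtend_zero]
    exact pure_le_nhds 0
  have nhds_coe (x : X) : 𝓝 (x : WithZero X) = pure ↑x :=
    nhds_nhdsAdjoint_of_ne _ WithZero.coe_ne_zero
  have cont : Continuous (zeroExtend h) := continuous_nhdsAdjoint_dom.2 tendsto_comap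
  have of_mul_eq_zero (a b : WithZero X) (hab : a * b = 0) :
      ContinuousAt (fun p : WithZero X × WithZero X => p.1 * p.2) (a, b) := by
    have key : ContinuousAt
        (fun p : WithZero X × WithZero X => zeroExtend h p.1 * zeroExtend h p.2) (a, b) :=
      ((cont.comp continuous_fst).mul (cont.comp continuous_snd)).continuousAt
    rw [ContinuousAt, ← map_mul, hab, zeroExtend_zero] at key
    rw [ContinuousAt, hab, nhds_zero, tendsto_comap_iff]
    exact key.congr fun p => (map_mul _ _ _).symm
  refine ⟨continuous_iff_continuousAt.2 ?_⟩
  rintro ⟨a, b⟩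
  cases a with
  | zero => exact of_mul_eq_zero _ _ (zero_mul _)
  | coe x =>
    cases b with
    | zero => exact of_mul_eq_zero _ _ (mul_zero _)
    | coe y =>
      rw [ContinuousAt, nhds_prod_eq, nhds_coe, nhds_coe, prod_pure_pure]
      exact tendsto_pure_nhds _ _

open Filter Topology in
theorem t2Space_nhdsAdjoint_comap {X Y : Type*} [Semigroup X] [Semigroup Y] (h : X →ₙ* Y)
    [TopologicalSpace (WithZero Y)] [T2Space (WithZero Y)] :
    @T2Space (WithZero X) (nhdsAdjoint 0 (comap (zeroExtend h) (𝓝 0))) := by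
  let _ : TopologicalSpace (WithZero X) := nhdsAdjoint 0 (comap (zeroExtend h) (𝓝 0))
  have nhds_coe (x : X) : 𝓝 (x : WithZero X) = pure ↑x :=
    nhds_nhdsAdjoint_of_ne _ WithZero.coe_ne_zero
  have disjoint_zero (x : X) : Disjoint (𝓝 (0 : WithZero X)) (𝓝 ↑x) := by
    have hx : {(h x : WithZero Y)}ᶜ ∈ 𝓝 (0 : WithZero Y) :=
      isOpen_compl_singleton.mem_nhds WithZero.coe_ne_zero.symm
    rw [nhds_coe, show 𝓝 (0 : WithZero X) = _ from nhds_nhdsAdjoint_same _ _, disjoint_sup_left]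
    refine ⟨disjoint_pure_pure.2 WithZero.coe_ne_zero.symm, ?_⟩
    refine Filter.disjoint_iff.2 ⟨_, preimage_mem_comap hx, {↑x}, mem_pure.2 rfl, ?_⟩
    simp [zeroExtend_coe]
  refine t2Space_iff_disjoint_nhds.2 fun a b hab => ?_
  cases a with
  | zero =>
    cases b with
    | zero => exact absurd rfl hab
    | coe y => exact disjoint_zero y
  | coe x =>
    cases b with
    | zero => exact (disjoint_zero x).symm
    | coe y =>
      rw [nhds_coe, nhds_coe]
      exact disjoint_pure_pure.2 hab

/-- If `h : X → Y` is a surjective semigroup homomorphism and `X` is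
zero-closed, then `Y` is zero-closed. -/
theorem statement10 {X : Type u} {Y : Type u} [Semigroup X] [Semigroup Y]
    (h : X →ₙ* Y) (hsurj : Function.Surjective h) (hz : ZeroClosed X) :
    ZeroClosed Y := by
  intro τ _ _
  have hX := hz _ (t2Space_nhdsAdjoint_comap h) (continuousMul_nhdsAdjoint_comap h)
  rw [range_coe_eq_compl_zero, @isClosed_compl_iff _ (nhdsAdjoint _ _)] at hX
  rw [range_coe_eq_compl_zero, isClosed_compl_iff, isOpen_singleton_iff_nhds_eq_pure]
  obtain ⟨V, hV, hVsub⟩ := hX rfl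
  refine le_antisymm (Filter.le_pure_iff.2 (Filter.mem_of_superset hV fun y hy => ?_))
    (pure_le_nhds _)
  obtain ⟨a, rfl⟩ := zeroExtend_surjective hsurj y
  rw [show a = 0 from hVsub hy]
  exact zeroExtend_zero h

end ZeroClosedPaper
end

section
/- Let X be a group and V a subset of X such that X = V·F for some finite set F ⊆ X. Then for any elements x, y ∈ X there exists an integer k with 1 ≤ k ≤ |F|² such that x^k ∈ V·V⁻¹ and y^k ∈ V·V⁻¹. -/
open Cardinal Pointwise

universe u

namespace ZeroClosedPaper

/-- If `X` is a group and `X = V·F` for a finite set `F`, then for all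
`x, y ∈ X` there is `k` with `1 ≤ k ≤ |F|²` and `x^k, y^k ∈ V·V⁻¹`. -/
theorem statement12 {X : Type u} [Group X] (V : Set X) (F : Finset X)
    (hVF : (Set.univ : Set X) = V * (F : Set X)) (x y : X) :
    ∃ k : ℕ, 1 ≤ k ∧ k ≤ F.card ^ 2 ∧ x ^ k ∈ V * V⁻¹ ∧ y ^ k ∈ V * V⁻¹ := by
  have hfac : ∀ z : X, ∃ v ∈ V, ∃ f ∈ F, v * f = z := fun z => by
    have hz : z ∈ V * (F : Set X) := hVF ▸ Set.mem_univ z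
    simpa [Set.mem_mul] using hz
  choose v hv f hf hvf using hfac
  have hquot : ∀ (z : X) (i j : ℕ), i ≤ j → f (z ^ i) = f (z ^ j) → z ^ (j - i) ∈ V * V⁻¹ := by
    intro z i j hij h
    refine Set.mem_mul.2 ⟨v (z ^ j), hv _, (v (z ^ i))⁻¹, Set.inv_mem_inv.2 (hv _), ?_⟩
    rw [pow_sub z hij, eq_mul_inv_of_mul_eq (hvf (z ^ j)), eq_mul_inv_of_mul_eq (hvf (z ^ i)), h]
    group
  have hcard : (F ×ˢ F).card < (Finset.range (F.card ^ 2 + 1)).card := by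
    rw [Finset.card_product, Finset.card_range, sq]
    exact Nat.lt_succ_self _
  obtain ⟨i, hi, j, hj, hne, hEq⟩ := Finset.exists_ne_map_eq_of_card_lt_of_maps_to hcard
    (f := fun n => (f (x ^ n), f (y ^ n)))
    (fun n _ => Finset.mem_product.2 ⟨hf _, hf _⟩)
  rw [Finset.mem_range] at hi hj
  obtain ⟨hx, hy⟩ := Prod.mk.inj hEq
  rcases hne.lt_or_gt with hlt | hlt
  · exact ⟨j - i, by omega, by omega, hquot x i j hlt.le hx, hquot y i j hlt.le hy⟩
  · exact ⟨i - j, by omega, by omega, hquot x j i hlt.le hx.symm, hquot y j i hlt.le hy.symm⟩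

end ZeroClosedPaper
end

section
/- Assume cov(N̄) = 𝔠, i.e., the real line is not the union of fewer than continuum many closed sets of Lebesgue measure zero. A zero-closed semigroup X is polyfinite if X admits a topology τ that is compact, Polish (separable and completely metrizable) and monomial. -/
open Cardinal Pointwise

universe u

namespace ZeroClosedPaper

/-- `PolyFun S n f` means that `f` is a semigroup polynomial of degree `n ≥ 1`,
`f x = a₀ * x * a₁ * ⋯ * x * aₙ`, whose coefficients are `1` or products of elements of `S`. -/
inductive PolyFun {X : Type*} [Semigroup X] (S : Set X) : ℕ → (X → X) → Prop
  | id : PolyFun S 1 (fun x => x)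
  | const_mul {n : ℕ} {f : X → X} {s : X} (hs : s ∈ S) (hf : PolyFun S n f) :
      PolyFun S n (fun x => s * f x)
  | mul_const {n : ℕ} {f : X → X} {s : X} (hs : s ∈ S) (hf : PolyFun S n f) :
      PolyFun S n (fun x => f x * s)
  | mul {n m : ℕ} {f g : X → X} (hf : PolyFun S n f) (hg : PolyFun S m g) :
      PolyFun S (n + m) (fun x => f x * g x)

namespace PolyFun

variable {X : Type*} [Semigroup X] {S : Set X} {n m : ℕ} {f g : X → X}

theorem mono {T : Set X} (hST : S ⊆ T) (hf : PolyFun S n f) : PolyFun T n f := by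
  induction hf with
  | id => exact .id
  | const_mul hs _ ih => exact .const_mul (hST hs) ih
  | mul_const hs _ ih => exact .mul_const (hST hs) ih
  | mul _ _ ihf ihg => exact .mul ihf ihg

theorem one_le (hf : PolyFun S n f) : 1 ≤ n := by
  induction hf <;> omega

theorem comp (hf : PolyFun S n f) (hg : PolyFun S m g) :
    PolyFun S (n * m) (fun x => f (g x)) := by
  induction hf with
  | id => simpa using hg
  | const_mul hs _ ih => exact .const_mul hs ih
  | mul_const hs _ ih => exact .mul_const hs ih
  | mul _ _ ihf ihg => rw [add_mul]; exact .mul ihf ihg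

theorem map_mem {S : Subsemigroup X} (hf : PolyFun (S : Set X) n f) {z : X} (hz : z ∈ S) :
    f z ∈ S := by
  induction hf with
  | id => exact hz
  | const_mul hs _ ih => exact S.mul_mem hs ih
  | mul_const hs _ ih => exact S.mul_mem ih hs
  | mul _ _ ihf ihg => exact S.mul_mem ihf ihg

theorem mem_closure (hf : PolyFun S n f) :
    f ∈ Subsemigroup.closure (insert (fun x => x) (Function.const X '' S)) := by
  induction hf with
  | id => exact Subsemigroup.subset_closure (Set.mem_insert _ _)
  | const_mul hs _ ih =>
    exact Subsemigroup.mul_mem _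
      (Subsemigroup.subset_closure (Set.mem_insert_of_mem _ (Set.mem_image_of_mem _ hs))) ih
  | mul_const hs _ ih =>
    exact Subsemigroup.mul_mem _ ih
      (Subsemigroup.subset_closure (Set.mem_insert_of_mem _ (Set.mem_image_of_mem _ hs)))
  | mul _ _ ihf ihg => exact Subsemigroup.mul_mem _ ihf ihg

/-- A polynomial in the inductive sense is given by a list of coefficients. -/
theorem exists_polyVal (hf : PolyFun S n f) :
    ∃ (a : WithOne X) (l : List (WithOne X)), l.length = n ∧
      ∀ x, polyVal (a :: l) x = (f x : WithOne X) := by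
  induction hf with
  | id => exact ⟨1, [1], rfl, fun x => by simp [polyVal]⟩
  | @const_mul n f s hs _ ih =>
    obtain ⟨a, l, hl, h⟩ := ih
    refine ⟨s * a, l, hl, fun x => ?_⟩
    rw [WithOne.coe_mul, ← h]
    simp [polyVal, mul_assoc]
  | @mul_const n f s hs hf ih =>
    obtain ⟨a, l, hl, h⟩ := ih
    have hl0 : l ≠ [] := by
      rintro rfl
      exact absurd hf.one_le (by simp [← hl])
    obtain ⟨l', b, rfl⟩ := (List.eq_nil_or_concat' l).resolve_left hl0
    refine ⟨a, l' ++ [b * s], by simpa using hl, fun x => ?_⟩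
    rw [WithOne.coe_mul, ← h]
    simp [polyVal, mul_assoc]
  | @mul n m f g hf hg ihf ihg =>
    obtain ⟨a, l, hl, h⟩ := ihf
    obtain ⟨c, k, hk, h'⟩ := ihg
    have hl0 : l ≠ [] := by
      rintro rfl
      exact absurd hf.one_le (by simp [← hl])
    obtain ⟨l', b, rfl⟩ := (List.eq_nil_or_concat' l).resolve_left hl0
    refine ⟨a, l' ++ [b * c] ++ k, by simp at hl; simp; omega, fun x => ?_⟩
    rw [WithOne.coe_mul, ← h, ← h']
    simp [polyVal, mul_assoc]

end PolyFun

theorem Polyfinite.of_polyFun {X : Type*} [Semigroup X] (N : ℕ) (F : Set X) (hF : F.Finite)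
    (h : ∀ x y : X, ∃ n ≤ N, ∃ f : X → X, PolyFun Set.univ n f ∧ f x ∈ F ∧ f y ∈ F) :
    Polyfinite X := by
  refine ⟨N, F, hF, fun x y => ?_⟩
  obtain ⟨n, hn, f, hf, hx, hy⟩ := h x y
  obtain ⟨a, l, hl, hval⟩ := hf.exists_polyVal
  have := hf.one_le
  exact ⟨a :: l, by simp; omega, by simp; omega, ⟨_, hx, hval x⟩, ⟨_, hy, hval y⟩⟩

theorem foldl_mul_eq_mul_foldl {M : Type*} [Semigroup M] (a b : M) (l : List M) :
    l.foldl (· * ·) (a * b) = a * l.foldl (· * ·) b := by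
  induction l generalizing b with
  | nil => rfl
  | cons c l ih => simp only [List.foldl_cons]; rw [mul_assoc, ih]

theorem mk_subsemigroup_closure_le {M : Type u} [Semigroup M] (s : Set M) :
    #(Subsemigroup.closure s) ≤ max ℵ₀ #s := by
  let F : s × List s → M := fun p => (p.2.map (↑)).foldl (· * ·) (p.1 : M)
  have hsub : (Subsemigroup.closure s : Set M) ⊆ Set.range F := by
    intro x hx
    induction hx using Subsemigroup.closure_induction with
    | mem x hx => exact ⟨(⟨x, hx⟩, []), rfl⟩
    | mul x y _ _ hx hy =>
      obtain ⟨⟨a, l⟩, rfl⟩ := hx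
      obtain ⟨⟨b, k⟩, rfl⟩ := hy
      refine ⟨(a, l ++ b :: k), ?_⟩
      simp only [F, List.map_append, List.map_cons, List.foldl_append, List.foldl_cons]
      exact foldl_mul_eq_mul_foldl _ _ _
  calc #(Subsemigroup.closure s) ≤ #(Set.range F) := mk_le_mk_of_subset hsub
    _ ≤ #(s × List s) := mk_range_le
    _ = #s * #(List s) := by rw [mk_prod, lift_id, lift_id]
    _ ≤ max ℵ₀ #s * max ℵ₀ #s := mul_le_mul' (le_max_right _ _) (mk_list_le_max _)
    _ = max ℵ₀ #s := mul_eq_self (le_max_left _ _)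

theorem mk_polyFun_lt {X : Type u} [Semigroup X] {S : Set X} {κ : Cardinal.{u}} (hκ : ℵ₀ < κ)
    (hS : #S < κ) : #{f : X → X | ∃ n, PolyFun S n f} < κ := by
  have hsub : {f : X → X | ∃ n, PolyFun S n f} ⊆
      (Subsemigroup.closure (insert (fun x => x) (Function.const X '' S)) : Set (X → X)) := by
    rintro f ⟨n, hf⟩
    exact hf.mem_closure
  refine (mk_le_mk_of_subset hsub).trans_lt ((mk_subsemigroup_closure_le _).trans_lt ?_)
  refine max_lt hκ (mk_insert_le.trans_lt (add_lt_of_lt hκ.le (mk_image_le.trans_lt hS) ?_))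
  exact one_lt_aleph0.trans hκ

/-- A zero-closed semigroup has no nontrivial filter base satisfying the axioms of the
neighborhoods of zero in a Hausdorff semigroup topology on `X⁰` with discrete `X`. -/
theorem ZeroClosed.exists_eq_empty {X : Type*} [Semigroup X] (hz : ZeroClosed X) {I : Type*}
    [LinearOrder I] [Nonempty I] (U : I → Set X) (hanti : Antitone U)
    (hmul : ∀ i, ∀ u ∈ U i, ∀ v ∈ U i, u * v ∈ U i)
    (hleft : ∀ i x, ∃ j, ∀ u ∈ U j, x * u ∈ U i)
    (hright : ∀ i x, ∃ j, ∀ u ∈ U j, u * x ∈ U i)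
    (hsep : ∀ x, ∃ i, x ∉ U i) : ∃ i, U i = ∅ := by
  let τ : TopologicalSpace (WithZero X) :=
    { IsOpen := fun V => (0 : WithZero X) ∈ V → ∃ i, ∀ u ∈ U i, (u : WithZero X) ∈ V
      isOpen_univ := fun _ => ⟨Classical.arbitrary I, fun _ _ => trivial⟩
      isOpen_inter := by
        rintro V W hV hW ⟨h0V, h0W⟩
        obtain ⟨i, hi⟩ := hV h0V
        obtain ⟨j, hj⟩ := hW h0W
        exact ⟨max i j, fun u hu =>
          ⟨hi u (hanti (le_max_left i j) hu), hj u (hanti (le_max_right i j) hu)⟩⟩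
      isOpen_sUnion := by
        rintro s hs ⟨V, hV, h0⟩
        obtain ⟨i, hi⟩ := hs V hV h0
        exact ⟨i, fun u hu => ⟨V, hV, hi u hu⟩⟩ }
  have isOpen_def : ∀ V : Set (WithZero X), IsOpen V ↔
      ((0 : WithZero X) ∈ V → ∃ i, ∀ u ∈ U i, (u : WithZero X) ∈ V) := fun V => Iff.rfl
  have isOpen_coe : ∀ x : X, IsOpen {(x : WithZero X)} := fun x =>
    (isOpen_def _).2 fun h => absurd h (by simp)
  have isOpen_nhds : ∀ i, IsOpen (insert (0 : WithZero X) ((↑) '' U i)) := fun i =>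
    (isOpen_def _).2 fun _ => ⟨i, fun u hu => Set.mem_insert_of_mem _ (Set.mem_image_of_mem _ hu)⟩
  have sep_zero : ∀ x : X, ∃ V W : Set (WithZero X), IsOpen V ∧ IsOpen W ∧ 0 ∈ V ∧
      (x : WithZero X) ∈ W ∧ Disjoint V W := by
    intro x
    obtain ⟨i, hi⟩ := hsep x
    exact ⟨_, _, isOpen_nhds i, isOpen_coe x, Set.mem_insert _ _, rfl, by simpa using hi⟩
  have hT2 : @T2Space (WithZero X) τ := by
    refine @T2Space.mk _ τ fun a b hab => ?_
    cases a with
    | zero =>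
      cases b with
      | zero => exact absurd rfl hab
      | coe b => exact sep_zero b
    | coe a =>
      cases b with
      | zero =>
        obtain ⟨V, W, hV, hW, h0, ha, hVW⟩ := sep_zero a
        exact ⟨W, V, hW, hV, ha, h0, hVW.symm⟩
      | coe b => exact ⟨_, _, isOpen_coe a, isOpen_coe b, rfl, rfl, by simpa using hab⟩
  have hcont : @ContinuousMul (WithZero X) τ _ := by
    refine @ContinuousMul.mk _ τ _ (continuous_def.2 fun V hV => ?_)
    refine isOpen_prod_iff.2 fun a b hab => ?_
    cases a with
    | zero =>
      cases b with
      | zero =>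
        obtain ⟨i, hi⟩ := (isOpen_def V).1 hV (by simpa using hab)
        refine ⟨_, _, isOpen_nhds i, isOpen_nhds i, Set.mem_insert _ _, Set.mem_insert _ _, ?_⟩
        rintro ⟨_, _⟩ ⟨rfl | ⟨u, hu, rfl⟩, rfl | ⟨v, hv, rfl⟩⟩
        · exact hab
        · simpa using hab
        · simpa using hab
        · exact hi _ (hmul i u hu v hv)
      | coe b =>
        obtain ⟨i, hi⟩ := (isOpen_def V).1 hV (by simpa using hab)
        obtain ⟨j, hj⟩ := hright i b
        refine ⟨_, _, isOpen_nhds j, isOpen_coe b, Set.mem_insert _ _, rfl, ?_⟩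
        rintro ⟨_, _⟩ ⟨rfl | ⟨u, hu, rfl⟩, rfl⟩
        · exact hab
        · exact hi _ (hj u hu)
    | coe a =>
      cases b with
      | zero =>
        obtain ⟨i, hi⟩ := (isOpen_def V).1 hV (by simpa using hab)
        obtain ⟨j, hj⟩ := hleft i a
        refine ⟨_, _, isOpen_coe a, isOpen_nhds j, rfl, Set.mem_insert _ _, ?_⟩
        rintro ⟨_, _⟩ ⟨rfl, rfl | ⟨u, hu, rfl⟩⟩
        · exact hab
        · exact hi _ (hj u hu)
      | coe b =>
        refine ⟨_, _, isOpen_coe a, isOpen_coe b, rfl, rfl, ?_⟩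
        rintro ⟨_, _⟩ ⟨rfl, rfl⟩
        exact hab
  have hclosed := hz τ hT2 hcont
  obtain ⟨i, hi⟩ := (isOpen_def _).1 hclosed.isOpen_compl (by simp)
  exact ⟨i, Set.eq_empty_iff_forall_notMem.2 fun u hu => hi u hu ⟨u, rfl⟩⟩

theorem exists_forall_of_wellFoundedLT {I X : Type*} [LinearOrder I] [WellFoundedLT I]
    (Q : ∀ i : I, (Set.Iio i → X) → X → Prop) (h : ∀ i p, ∃ z, Q i p z) :
    ∃ z : I → X, ∀ i, Q i (fun j => z j) (z i) := by
  choose F hF using h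
  let z : I → X := (wellFounded_lt (α := I)).fix fun i p => F i fun j => p j.1 j.2
  refine ⟨z, fun i => ?_⟩
  have : z i = F i (fun j => z j) := (wellFounded_lt (α := I)).fix_eq _ i
  rw [this]
  exact hF i _

/-- In a zero-closed semigroup, any set is covered by the algebraic sets defined over some small
subsemigroup. -/
theorem ZeroClosed.exists_subsemigroup {X : Type u} [Semigroup X] [Nonempty X]
    (hz : ZeroClosed X) {κ : Cardinal.{u}} (hκ : ℵ₀ < κ) (hX : #X ≤ κ) (Z : Set X) :
    ∃ S : Subsemigroup X, #S < κ ∧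
      ∀ z ∈ Z, ∃ n f, PolyFun (S : Set X) n f ∧ f z ∈ S := by
  by_contra! hcon
  let I := κ.ord.ToType
  have hI : #I = κ := mk_ord_toType κ
  have : Nonempty I := by
    rw [← mk_ne_zero_iff, hI]
    exact (aleph0_pos.trans hκ).ne'
  obtain ⟨x, hx⟩ : ∃ x : I → X, Function.Surjective x := by
    obtain ⟨e⟩ := Cardinal.le_def X I |>.1 (hX.trans_eq hI.symm)
    exact ⟨Function.invFun e, Function.invFun_surjective e.injective⟩
  let S : ∀ i : I, (Set.Iio i → X) → Subsemigroup X := fun i p =>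
    Subsemigroup.closure (x '' Set.Iic i ∪ Set.range p)
  have hS : ∀ i p, #(S i p) < κ := by
    intro i p
    refine (mk_subsemigroup_closure_le _).trans_lt (max_lt hκ ?_)
    refine (mk_union_le _ _).trans_lt (add_lt_of_lt hκ.le ?_ ?_)
    · have := mk_Iic_lt i (by simp [I]) (hI ▸ hκ.le)
      rw [hI] at this
      exact mk_image_le.trans_lt this
    · have := mk_Iio_lt i (by simp [I])
      rw [hI] at this
      exact mk_range_le.trans_lt this
  obtain ⟨z, hzI⟩ := exists_forall_of_wellFoundedLT
    (fun i p w => ∀ n f, PolyFun (S i p : Set X) n f → f w ∉ S i p)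
    fun i p => let ⟨w, _, hw⟩ := hcon (S i p) (hS i p); ⟨w, hw⟩
  let T : I → Subsemigroup X := fun i => S i fun j => z j
  have hxT : ∀ {i j}, i ≤ j → x i ∈ T j := fun h =>
    Subsemigroup.subset_closure (Or.inl (Set.mem_image_of_mem _ h))
  have hzT : ∀ {i j}, i < j → z i ∈ T j := fun {i j} h =>
    Subsemigroup.subset_closure (Or.inr ⟨⟨i, h⟩, rfl⟩)
  have hTmono : ∀ {i j}, i ≤ j → T i ≤ T j := by
    intro i j hij
    refine Subsemigroup.closure_le.2 ?_
    rintro _ (⟨k, hk, rfl⟩ | ⟨⟨k, hk⟩, rfl⟩)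
    · exact hxT (le_trans hk hij)
    · exact hzT (lt_of_lt_of_le hk hij)
  let U : I → Set X := fun i => {v | ∃ j, i ≤ j ∧ ∃ n f, PolyFun (T j : Set X) n f ∧ v = f (z j)}
  suffices hU : ∃ i, U i = ∅ by
    obtain ⟨i, hi⟩ := hU
    have hzi : z i ∈ U i := ⟨i, le_rfl, 1, _, .id, rfl⟩
    rw [hi] at hzi
    exact hzi
  refine hz.exists_eq_empty U (fun i j hij v ⟨k, hk, h⟩ => ⟨k, hij.trans hk, h⟩) ?_ ?_ ?_ ?_
  · rintro i _ ⟨j, hij, n, f, hf, rfl⟩ _ ⟨k, hik, m, g, hg, rfl⟩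
    rcases lt_trichotomy j k with h | rfl | h
    · exact ⟨k, hik, _, _, .const_mul ((hf.mono (hTmono h.le)).map_mem (hzT h)) hg, rfl⟩
    · exact ⟨j, hij, _, _, .mul hf hg, rfl⟩
    · exact ⟨j, hij, _, _, .mul_const ((hg.mono (hTmono h.le)).map_mem (hzT h)) hf, rfl⟩
  · intro i y
    obtain ⟨k, rfl⟩ := hx y
    refine ⟨max i k, ?_⟩
    rintro _ ⟨j, hj, n, f, hf, rfl⟩
    exact ⟨j, (le_max_left _ _).trans hj, _, _,
      .const_mul (hxT ((le_max_right _ _).trans hj)) hf, rfl⟩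
  · intro i y
    obtain ⟨k, rfl⟩ := hx y
    refine ⟨max i k, ?_⟩
    rintro _ ⟨j, hj, n, f, hf, rfl⟩
    exact ⟨j, (le_max_left _ _).trans hj, _, _,
      .mul_const (hxT ((le_max_right _ _).trans hj)) hf, rfl⟩
  · intro y
    obtain ⟨k, rfl⟩ := hx y
    refine ⟨k, ?_⟩
    rintro ⟨j, hj, n, f, hf, h⟩
    exact hzI j n f hf (h ▸ hxT hj)

open MeasureTheory in
/-- No nonempty interval is covered by fewer than `cov(N̄)` closed null sets. -/
theorem not_Ioo_subset_iUnion {J : Type u}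
    (hcov : ℵ₀ < covClosedNull) (hJ : #J < lift.{u} covClosedNull) (K : J → Set ℝ)
    (hK : ∀ j, IsClosed (K j)) (hK0 : ∀ j, volume (K j) = 0) {a b : ℝ} (hab : a < b) :
    ¬ Set.Ioo a b ⊆ ⋃ j, K j := by
  intro hsub
  let L : J × ℚ → Set ℝ := fun p => (fun x : ℝ => x - p.2) ⁻¹' K p.1
  have hle : covClosedNull ≤ #(Set.range L) := by
    refine csInf_le' ⟨Set.range L, ?_, ?_, rfl⟩
    · rintro _ ⟨⟨j, q⟩, rfl⟩
      refine ⟨(hK j).preimage (by fun_prop), ?_⟩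
      simpa only [L, sub_eq_add_neg, measure_preimage_add_right] using hK0 j
    · refine Set.eq_univ_of_forall fun x => ?_
      obtain ⟨q, hq1, hq2⟩ := exists_rat_btwn (show x - b < x - a by linarith)
      obtain ⟨j, hj⟩ := Set.mem_iUnion.1 (hsub (show x - q ∈ Set.Ioo a b from
        ⟨by linarith, by linarith⟩))
      exact ⟨L (j, q), ⟨_, rfl⟩, hj⟩
  have hlt : lift.{u} #(Set.range L) < lift.{u} covClosedNull := by
    have hℵ : ℵ₀ < lift.{u} covClosedNull := aleph0_lt_lift.2 hcov
    refine mk_range_le_lift.trans_lt ?_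
    simpa using mul_lt_of_lt hℵ.le hJ hℵ
  exact absurd (lift_le.2 hle) hlt.not_ge

open MeasureTheory ProbabilityTheory Filter Topology in
/-- The distribution function of an atomless probability measure concentrated on a compact set. -/
theorem exists_continuous_volume_image_le (ν : Measure ℝ) [IsProbabilityMeasure ν]
    [NullSingletonClass ν] {C : Set ℝ} (hC : IsCompact C) (hνC : ν Cᶜ = 0) :
    ∃ G : ℝ → ℝ, Continuous G ∧ Set.Ioo 0 1 ⊆ G '' C ∧ ∀ s, volume (G '' s) ≤ ν s := by
  have hcont : Continuous (cdf ν) := by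
    refine continuous_iff_continuousAt.2 fun x => ?_
    rw [(cdf ν).mono.continuousAt_iff_leftLim_eq_rightLim, StieltjesFunction.rightLim_eq]
    have h := (cdf ν).measure_singleton x
    rw [measure_cdf, measure_singleton, eq_comm, ENNReal.ofReal_eq_zero] at h
    exact le_antisymm ((cdf ν).mono.leftLim_le le_rfl) (by linarith)
  have hvol : ∀ s, volume (cdf ν '' s) ≤ ν s := by
    have h : OuterMeasure.comap (cdf ν) (volume : Measure ℝ).toOuterMeasure ≤ (cdf ν).outer := by
      refine OuterMeasure.le_ofFunction.2 fun s => ?_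
      rw [StieltjesFunction.length_eq]
      refine le_iInf fun a => le_iInf fun b => le_iInf fun hs => ?_
      have hbot : (botSet : Set ℝ) = ∅ := Set.eq_empty_of_forall_notMem fun x hx => not_isBot x hx
      rw [hbot, Set.sdiff_empty] at hs
      rw [OuterMeasure.comap_apply]
      refine (measure_mono ?_).trans_eq (Real.volume_Icc (a := cdf ν a) (b := cdf ν b))
      rintro _ ⟨x, hx, rfl⟩
      exact ⟨monotone_cdf ν (hs hx).1.le, monotone_cdf ν (hs hx).2⟩
    intro s
    have h' := h s
    conv_rhs => rw [← measure_cdf ν]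
    rw [StieltjesFunction.measure]
    exact h'
  refine ⟨cdf ν, hcont, ?_, hvol⟩
  have hempty : Set.Ioo 0 1 \ cdf ν '' C = ∅ := by
    refine (IsOpen.measure_eq_zero_iff (μ := volume)
      (isOpen_Ioo.sdiff (hC.image hcont).isClosed)).1 ?_
    refine measure_mono_null ?_ (le_antisymm ((hvol Cᶜ).trans_eq hνC) zero_le)
    rintro t ⟨ht, htC⟩
    obtain ⟨a, ha⟩ := ((tendsto_cdf_atBot ν).eventually_lt_const ht.1).exists
    obtain ⟨b, hb⟩ := ((tendsto_cdf_atTop ν).eventually_const_lt ht.2).exists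
    obtain ⟨x, rfl⟩ := mem_range_of_exists_le_of_exists_ge hcont ⟨a, ha.le⟩ ⟨b, hb.le⟩
    exact ⟨x, fun hx => htC ⟨x, hx, rfl⟩, rfl⟩
  exact Set.sdiff_eq_empty.1 hempty

open MeasureTheory ProbabilityTheory in
/-- A Polish space carrying a nonzero atomless finite measure is not covered by fewer than `cov(N̄)`
closed null sets. -/
theorem exists_measure_ne_zero {H : Type u} [t : TopologicalSpace H] [PolishSpace H]
    [MeasurableSpace H] [BorelSpace H] (μ : Measure H) [IsFiniteMeasure μ] [NullSingletonClass μ]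
    (hμ : μ ≠ 0) (hcov : ℵ₀ < covClosedNull) {J : Type u}
    (hJ : #J < lift.{u} covClosedNull) (A : J → Set H) (hA : ∀ j, IsClosed (A j))
    (hU : ⋃ j, A j = Set.univ) : ∃ j, μ (A j) ≠ 0 := by
  by_contra! hnull
  have hι : MeasurableEmbedding (embeddingReal H) := measurableEmbedding_embeddingReal H
  obtain ⟨t', ht', hιt', hpol⟩ := hι.measurable.exists_continuous
  have hbor : @BorelSpace H t' _ := by
    constructor
    rw [borel_eq_borel_of_le hpol (t := t') (t' := t) ‹_› ht']
    exact BorelSpace.measurable_eq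
  obtain ⟨C, -, ⟨hC, -⟩, hμC⟩ :=
    (@innerRegular_isCompact_isClosed_measurableSet_of_finite H _ t' inferInstance inferInstance
      hbor μ _) MeasurableSet.univ 0 (by simpa [pos_iff_ne_zero] using hμ)
  have hCm : MeasurableSet C := (@IsCompact.isClosed H t' _ _ hC).measurableSet
  have hιA : ∀ j, IsCompact (embeddingReal H '' (A j ∩ C)) := fun j =>
    (hC.inter_left ((hA j).mono ht')).image hιt'
  have : IsProbabilityMeasure (μ[|C]) := cond_isProbabilityMeasure hμC.ne'
  let ν := (μ[|C]).map (embeddingReal H)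
  have hν : IsProbabilityMeasure ν := Measure.isProbabilityMeasure_map hι.measurable.aemeasurable
  have hνa : NullSingletonClass ν := by
    refine ⟨fun x => ?_⟩
    rw [hι.map_apply]
    exact cond_absolutelyContinuous
      ((Set.subsingleton_singleton.preimage hι.injective).measure_zero μ)
  obtain ⟨G, hG, hGC, hGν⟩ := exists_continuous_volume_image_le ν (hC.image hιt') (by
    rw [hι.map_apply, Set.preimage_compl, hι.injective.preimage_image]
    exact ae_cond_mem hCm)
  refine not_Ioo_subset_iUnion hcov (by simpa using hJ)
    (fun j => G '' (embeddingReal H '' (A j ∩ C)))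
    (fun j => ((hιA j).image hG).isClosed) (fun j => ?_) zero_lt_one (hGC.trans ?_)
  · refine le_antisymm ((hGν _).trans_eq ?_) zero_le
    rw [hι.map_apply, hι.injective.preimage_image]
    exact cond_absolutelyContinuous (measure_mono_null Set.inter_subset_left (hnull j))
  · rintro _ ⟨_, ⟨x, hx, rfl⟩, rfl⟩
    obtain ⟨j, hj⟩ := Set.mem_iUnion.1 (hU.symm ▸ Set.mem_univ x)
    exact Set.mem_iUnion.2 ⟨j, _, ⟨x, ⟨hj, hx⟩, rfl⟩, rfl⟩

/-- A compact Hausdorff semigroup with separately continuous multiplication contains an idempotent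
`e` such that every element of `e X e` has a left inverse in `e X e`. -/
theorem exists_idempotent_forall_exists_mul_eq {X : Type*} [Semigroup X]
    [TopologicalSpace X] [Nonempty X] [CompactSpace X] [T2Space X]
    (hr : ∀ a : X, Continuous (fun x => x * a)) :
    ∃ e : X, e * e = e ∧ ∀ x, e * x = x → x * e = x → ∃ y, e * y = y ∧ y * e = y ∧ y * x = e := by
  let S : Set (Set X) := {L | IsClosed L ∧ L.Nonempty ∧ ∀ a, ∀ x ∈ L, a * x ∈ L}
  obtain ⟨L, hL⟩ : ∃ L, Minimal (· ∈ S) L := by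
    refine zorn_superset S fun c hcs hc => ?_
    refine ⟨⋂₀ c, ⟨isClosed_sInter fun t ht => (hcs ht).1, ?_, fun a x hx t ht => ?_⟩, fun s hs =>
      Set.sInter_subset_of_mem hs⟩
    · obtain rfl | hcnemp := c.eq_empty_or_nonempty
      · rw [Set.sInter_empty]
        exact Set.univ_nonempty
      · have := hcnemp.to_subtype
        exact IsCompact.nonempty_sInter_of_directed_nonempty_isCompact_isClosed
          (fun s hs t ht => (hc.total hs ht).elim
            (fun h => ⟨s, hs, subset_rfl, h⟩) fun h => ⟨t, ht, h, subset_rfl⟩)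
          (fun t ht => (hcs ht).2.1)
          (fun t ht => (hcs ht).1.isCompact) (fun t ht => (hcs ht).1)
    · exact (hcs ht).2.2 a x (hx t ht)
  obtain ⟨hLc, hLn, hLi⟩ := hL.prop
  obtain ⟨e, he, hee⟩ := exists_idempotent_in_compact_subsemigroup hr L hLn hLc.isCompact
    (fun x _ y hy => hLi x y hy)
  refine ⟨e, hee, fun x hex hxe => ?_⟩
  have hxL : x ∈ L := hxe ▸ hLi x e he
  have hrange : Set.range (fun a => a * x) = L := by
    refine hL.eq_of_subset ⟨(isCompact_range (hr x)).isClosed, ⟨_, ⟨e, rfl⟩⟩, ?_⟩ ?_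
    · rintro a _ ⟨b, rfl⟩
      exact ⟨a * b, mul_assoc a b x⟩
    · rintro _ ⟨a, rfl⟩
      exact hLi a x hxL
  obtain ⟨y, hy : y * x = e⟩ := hrange.symm ▸ he
  refine ⟨e * y * e, ?_, ?_, ?_⟩
  · rw [← mul_assoc, ← mul_assoc, hee]
  · rw [mul_assoc, hee]
  · rw [mul_assoc, hex, mul_assoc, hy, hee]

open TopologicalSpace Topology in
/-- **Ellis' theorem** for compact metrizable groups: separate continuity of multiplication implies
joint continuity. -/
theorem isTopologicalGroup_of_separatelyContinuous {G : Type*} [Group G] [TopologicalSpace G]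
    [CompactSpace G] [MetrizableSpace G] (hl : ∀ a : G, Continuous (fun x => a * x))
    (hr : ∀ a : G, Continuous (fun x => x * a)) : IsTopologicalGroup G := by
  let _ : MetricSpace G := metrizableSpaceMetric G
  let A : ℕ → ℕ → Set G := fun k n =>
    {x | ∀ y y', dist y y' ≤ 1 / ((n : ℝ) + 1) → dist (x * y) (x * y') ≤ 1 / ((k : ℝ) + 1)}
  have hA : ∀ k n, IsClosed (A k n) := fun k n => by
    simp only [A, Set.ofPred_forall]
    exact isClosed_iInter fun y => isClosed_iInter fun y' => isClosed_iInter fun _ =>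
      isClosed_le ((hr y).dist (hr y')) continuous_const
  have hU : ∀ k, ⋃ n, A k n = Set.univ := fun k => by
    refine Set.eq_univ_of_forall fun x => ?_
    obtain ⟨δ, hδ, h⟩ := Metric.uniformContinuous_iff.1
      (CompactSpace.uniformContinuous_of_continuous (hl x)) (1 / ((k : ℝ) + 1)) (by positivity)
    obtain ⟨n, hn⟩ := exists_nat_one_div_lt hδ
    exact Set.mem_iUnion.2 ⟨n, fun y y' hy => (h (hy.trans_lt hn)).le⟩
  have hdense : Dense (⋂ k, ⋃ n, interior (A k n)) :=
    dense_iInter_of_isOpen (fun k => isOpen_iUnion fun n => isOpen_interior)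
      fun k => dense_iUnion_interior_of_closed (hA k) (hU k)
  obtain ⟨a, ha⟩ := hdense.nonempty
  have hcont : ∀ y, ContinuousAt (fun p : G × G => p.1 * p.2) (a, y) := fun y => by
    refine Metric.tendsto_nhds.2 fun ε hε => ?_
    obtain ⟨k, hk⟩ := exists_nat_one_div_lt (half_pos hε)
    obtain ⟨n, hn⟩ := Set.mem_iUnion.1 (Set.mem_iInter.1 ha k)
    have h1 : ∀ᶠ p : G × G in 𝓝 (a, y), p.1 ∈ interior (A k n) :=
      continuous_fst.continuousAt.eventually_mem (isOpen_interior.mem_nhds hn)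
    have h2 : ∀ᶠ p : G × G in 𝓝 (a, y), dist p.2 y < 1 / ((n : ℝ) + 1) :=
      Metric.tendsto_nhds.1 (continuous_snd.tendsto (a, y)) _ (by positivity)
    have h3 : ∀ᶠ p : G × G in 𝓝 (a, y), dist (p.1 * y) (a * y) < ε / 2 :=
      Metric.tendsto_nhds.1 (((hr y).comp continuous_fst).tendsto (a, y)) _ (half_pos hε)
    filter_upwards [h1, h2, h3] with p h1 h2 h3
    have h4 := interior_subset h1 p.2 y h2.le
    linarith [dist_triangle (p.1 * p.2) (p.1 * y) (a * y)]
  have hmul : ContinuousMul G := by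
    refine ⟨continuous_iff_continuousAt.2 fun ⟨x, y⟩ => ?_⟩
    have h : ContinuousAt (fun p : G × G => (a * x⁻¹ * p.1, p.2)) (x, y) :=
      (((hl _).comp continuous_fst).prodMk continuous_snd).continuousAt
    have h' : ContinuousAt (fun p : G × G => a * x⁻¹ * p.1 * p.2) (x, y) :=
      ContinuousAt.comp (g := fun p : G × G => p.1 * p.2)
        (by simpa only [inv_mul_cancel_right] using hcont y) h
    convert! (hl (x * a⁻¹)).continuousAt.comp h' using 2 with p
    simp [mul_assoc]
  refine { hmul with continuous_inv := continuous_iff_isClosed.2 fun F hF => ?_ }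
  have hclosed : IsClosed ({p : G × G | p.1 * p.2 = 1} ∩ Prod.snd ⁻¹' F) :=
    (isClosed_eq continuous_mul continuous_const).inter (hF.preimage continuous_snd)
  convert! (hclosed.isCompact.image continuous_fst).isClosed using 1
  ext x
  constructor
  · exact fun hx => ⟨(x, x⁻¹), ⟨mul_inv_cancel x, hx⟩, rfl⟩
  · rintro ⟨⟨x, y⟩, ⟨hxy, hy⟩, rfl⟩
    simpa [inv_eq_of_mul_eq_one_right hxy] using hy

/-- The kernel of a compact semigroup contains a compact topological group `e X e`. -/
theorem exists_topologicalGroup {X : Type u} [Semigroup X] [TopologicalSpace X] [Nonempty X]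
    [CompactSpace X] [PolishSpace X]
    (hl : ∀ a : X, Continuous (fun x => a * x)) (hr : ∀ a : X, Continuous (fun x => x * a)) :
    ∃ (G : Type u) (_ : Group G) (_ : TopologicalSpace G) (j : G →ₙ* X), CompactSpace G ∧
      PolishSpace G ∧ IsTopologicalGroup G ∧ Continuous j ∧ ∀ x, ∃ g, j g = j 1 * x * j 1 := by
  obtain ⟨e, hee, he⟩ := exists_idempotent_forall_exists_mul_eq hr
  let H : Set X := {x | e * x = x ∧ x * e = x}
  have hH : IsClosed H := (isClosed_eq (hl e) continuous_id).inter (isClosed_eq (hr e) continuous_id)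
  choose! v hv1 hv2 hv3 using he
  let _ : Mul H := ⟨fun x y => ⟨x.1 * y.1, by
    constructor
    · rw [← mul_assoc, x.2.1]
    · rw [mul_assoc, y.2.2]⟩⟩
  let _ : One H := ⟨⟨e, hee, hee⟩⟩
  let _ : Inv H := ⟨fun x => ⟨v x.1, hv1 _ x.2.1 x.2.2, hv2 _ x.2.1 x.2.2⟩⟩
  let _ : Group H := Group.ofLeftAxioms (fun x y z => Subtype.ext (mul_assoc x.1 y.1 z.1))
    (fun x => Subtype.ext x.2.1) (fun x => Subtype.ext (hv3 _ x.2.1 x.2.2))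
  have : CompactSpace H := isCompact_iff_compactSpace.1 hH.isCompact
  have : PolishSpace H := hH.polishSpace
  refine ⟨H, inferInstance, inferInstance, ⟨Subtype.val, fun _ _ => rfl⟩, inferInstance,
    inferInstance, isTopologicalGroup_of_separatelyContinuous
      (fun a => ((hl a.1).comp continuous_subtype_val).subtype_mk _)
      (fun a => ((hr a.1).comp continuous_subtype_val).subtype_mk _),
    continuous_subtype_val, fun x => ⟨⟨e * x * e, ?_, ?_⟩, rfl⟩⟩
  · rw [← mul_assoc, ← mul_assoc, hee]
  · rw [mul_assoc, hee]

namespace PolyFun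

variable {X G : Type*} [Semigroup X] [Group G] [TopologicalSpace G] [IsTopologicalGroup G]
  {j : G →ₙ* X} {S : Set X} {n : ℕ} {f : X → X}

/-- On a group of the form `e X e`, semigroup polynomials of `X` act by polynomials of the group. -/
theorem exists_continuous_apply_eq (hj : ∀ x, ∃ g, j g = j 1 * x * j 1) (hf : PolyFun S n f) :
    ∃ (a b : X) (φ : G → G), Continuous φ ∧ ∀ h, f (j h) = a * j (φ h) * b := by
  induction hf with
  | id => exact ⟨j 1, j 1, fun h => h, continuous_id, fun h => by simp [← map_mul]⟩
  | @const_mul n f s _ _ ih =>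
    obtain ⟨a, b, φ, hφ, h⟩ := ih
    exact ⟨s * a, b, φ, hφ, fun x => by simp only [h, mul_assoc]⟩
  | @mul_const n f s _ _ ih =>
    obtain ⟨a, b, φ, hφ, h⟩ := ih
    exact ⟨a, b * s, φ, hφ, fun x => by simp only [h, mul_assoc]⟩
  | @mul n m f g' _ _ ihf ihg =>
    obtain ⟨a, b, φ, hφ, h⟩ := ihf
    obtain ⟨a', b', ψ, hψ, h'⟩ := ihg
    obtain ⟨g, hg⟩ := hj (b * a')
    refine ⟨a, b', fun x => φ x * g * ψ x, by fun_prop, fun x => ?_⟩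
    have h1 : j (φ x) * j 1 = j (φ x) := by rw [← map_mul, mul_one]
    have h2 : j 1 * j (ψ x) = j (ψ x) := by rw [← map_mul, one_mul]
    calc f (j x) * g' (j x) = a * (j (φ x) * j 1) * (b * a') * (j 1 * j (ψ x)) * b' := by
          rw [h, h', h1, h2]; simp only [mul_assoc]
      _ = a * j (φ x * g * ψ x) * b' := by simp only [map_mul, hg, mul_assoc]

theorem continuous_comp [TopologicalSpace X] (hl : ∀ a : X, Continuous (fun x => a * x))
    (hr : ∀ a : X, Continuous (fun x => x * a)) (hjc : Continuous j)
    (hj : ∀ x, ∃ g, j g = j 1 * x * j 1) (hf : PolyFun S n f) :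
    Continuous (fun h => f (j h)) := by
  obtain ⟨a, b, φ, hφ, h⟩ := hf.exists_continuous_apply_eq hj
  simp only [h]
  exact (hr b).comp ((hl a).comp (hjc.comp hφ))

end PolyFun

/-- The `k`-th power of a group inside `X` is given by a semigroup polynomial of degree `k`. -/
theorem PolyFun.exists_pow {X G : Type*} [Semigroup X] [Group G] (j : G →ₙ* X) {k : ℕ}
    (hk : k ≠ 0) : ∃ p : X → X, PolyFun Set.univ k p ∧ ∀ g, p (j g) = j (g ^ k) := by
  induction k, Nat.one_le_iff_ne_zero.2 hk using Nat.le_induction with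
  | base => exact ⟨_, .id, fun g => by rw [pow_one]⟩
  | succ k hk ih =>
    obtain ⟨p, hp, h⟩ := ih (by omega)
    exact ⟨_, hp.mul .id, fun g => by rw [h, pow_succ, map_mul]⟩

open MeasureTheory in
/-- In a group with a finite invariant measure, some power `g ^ k` with `k` bounded by the measure
of `E` moves a point of `E` to a point of `E`. -/
theorem exists_pow_mul_mem {G : Type*} [Group G] [MeasurableSpace G] [MeasurableMul G]
    (μ : Measure G) [IsFiniteMeasure μ] [μ.IsMulLeftInvariant] {E : Set G} (hE : MeasurableSet E)
    (hμE : μ E ≠ 0) : ∃ N : ℕ, ∀ g : G, ∃ k ≠ 0, k ≤ N ∧ ∃ a ∈ E, g ^ k * a ∈ E := by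
  obtain ⟨N, hN⟩ := ENNReal.exists_nat_mul_gt hμE (measure_ne_top μ Set.univ)
  refine ⟨N, fun g => ?_⟩
  obtain ⟨i, hi, k, hk, hik, a, ha1, ha2⟩ := exists_nonempty_inter_of_measure_univ_lt_sum_measure μ
    (s := Finset.range N) (t := fun i => (fun x => g ^ i * x) ⁻¹' E)
    (fun i _ => (measurable_const_mul (g ^ i) hE).nullMeasurableSet)
    (by simpa [measure_preimage_mul] using hN)
  rw [Finset.mem_range] at hi hk
  rcases hik.lt_or_gt with h | h
  · exact ⟨k - i, by omega, by omega, g ^ i * a, ha1, by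
      rwa [← mul_assoc, ← pow_add, Nat.sub_add_cancel h.le]⟩
  · exact ⟨i - k, by omega, by omega, g ^ k * a, ha2, by
      rwa [← mul_assoc, ← pow_add, Nat.sub_add_cancel h.le]⟩

open MeasureTheory Topology in
/-- Under `cov(N̄) = 𝔠`, a zero-closed semigroup admitting a compact
Polish monomial topology is polyfinite. -/
theorem statement14 {X : Type u} [Semigroup X] (hz : ZeroClosed X)
    (htop : ∃ τ : TopologicalSpace X, @CompactSpace X τ ∧ @PolishSpace X τ ∧
      (∀ a : X, @Continuous X X τ τ (fun x => a * x)) ∧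
      (∀ a : X, @Continuous X X τ τ (fun x => x * a)))
    (hcov : covClosedNull = Cardinal.continuum) :
    Polyfinite X := by
  obtain ⟨τ, hc, hp, hl, hr⟩ := htop
  rcases isEmpty_or_nonempty X with hX | hX
  · exact ⟨0, ∅, Set.finite_empty, fun x => hX.elim x⟩
  obtain ⟨G, _, _, j, _, _, _, hjc, hj⟩ := exists_topologicalGroup hl hr
  have hp1 : PolyFun Set.univ 1 (fun x : X => j 1 * x * j 1) :=
    .mul_const (Set.mem_univ _) (.const_mul (Set.mem_univ _) .id)
  rcases finite_or_infinite G with hG | hG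
  · refine Polyfinite.of_polyFun 1 (Set.range j) (Set.finite_range j) fun x y => ?_
    obtain ⟨g, hg⟩ := hj x
    obtain ⟨h, hh⟩ := hj y
    exact ⟨1, le_rfl, _, hp1, ⟨g, hg⟩, ⟨h, hh⟩⟩
  have hℵ : ℵ₀ < covClosedNull := hcov ▸ aleph0_lt_continuum
  have hXc : #X ≤ 𝔠 := by
    borelize X
    have h := lift_mk_le_lift_mk_of_injective (measurableEmbedding_embeddingReal X).injective
    rwa [mk_real, lift_continuum, lift_le_continuum] at h
  borelize G
  obtain ⟨n, f, hf, c, hfc⟩ : ∃ n f, PolyFun Set.univ n f ∧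
      ∃ c : X, Measure.haar {h | f (j h) = c} ≠ 0 := by
    obtain ⟨S, hS, hSj⟩ := hz.exists_subsemigroup aleph0_lt_continuum hXc (Set.range j)
    have hJ : #({f : X → X | ∃ n, PolyFun (S : Set X) n f} × S) < lift.{u} covClosedNull := by
      rw [hcov, lift_continuum, mk_prod, lift_id, lift_id]
      exact mul_lt_of_lt aleph0_lt_continuum.le (mk_polyFun_lt aleph0_lt_continuum hS) hS
    have : (𝓝[≠] (1 : G)).NeBot := by
      refine ⟨fun h => ?_⟩
      have := discreteTopology_of_isOpen_singleton_one
        ((isOpen_singleton_iff_punctured_nhds (1 : G)).2 h)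
      exact not_finite_iff_infinite.2 hG finite_of_compact_of_discrete
    obtain ⟨⟨⟨f, n, hf⟩, c⟩, h⟩ := exists_measure_ne_zero (Measure.haar : Measure G)
      (NeZero.ne _) hℵ hJ (fun p => {h | p.1.1 (j h) = p.2})
      (fun ⟨⟨f, n, hf⟩, c⟩ => isClosed_eq (hf.continuous_comp hl hr hjc hj) continuous_const)
      (Set.eq_univ_of_forall fun h => by
        obtain ⟨n, f, hf, hfS⟩ := hSj _ ⟨h, rfl⟩
        exact Set.mem_iUnion.2 ⟨⟨⟨f, n, hf⟩, ⟨_, hfS⟩⟩, rfl⟩)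
    exact ⟨n, f, hf.mono (Set.subset_univ _), c, h⟩
  have hE : IsClosed {h | f (j h) = c} :=
    isClosed_eq (hf.continuous_comp hl hr hjc hj) continuous_const
  obtain ⟨N, hN⟩ := exists_pow_mul_mem Measure.haar hE.measurableSet hfc
  refine Polyfinite.of_polyFun (n * N) {c} (Set.finite_singleton c) fun x y => ?_
  obtain ⟨g, hg⟩ := hj x
  obtain ⟨h, hh⟩ := hj y
  obtain ⟨k, hk0, hkN, a, ha, hka⟩ := hN (h * g⁻¹)
  obtain ⟨p, hp, hpj⟩ := PolyFun.exists_pow j hk0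
  refine ⟨n * k, Nat.mul_le_mul_left n hkN, _, hf.comp (.mul_const (Set.mem_univ (j a))
    (by simpa using hp.comp (.mul_const (Set.mem_univ (j g⁻¹)) hp1))), ?_, ?_⟩
  · rw [← hg, ← map_mul, hpj, ← map_mul, mul_inv_cancel, one_pow, one_mul]
    exact ha
  · rw [← hh, ← map_mul, hpj, ← map_mul]
    exact hka

end ZeroClosedPaper
end

section
/- Let X be a semigroup such that for every injective homomorphism h : X → Y into a Hausdorff 0-discrete topological semigroup Y the image h[X] is closed in Y. Then X is zero-closed. (In particular, if C is any class of topological semigroups containing all 0-discrete Hausdorff topological semigroups, then every injectively C-closed semigroup is zero-closed.) -/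
open Cardinal Pointwise

universe u

open scoped Topology

namespace ZeroClosedPaper

/-- Refining a semigroup topology on a semigroup with zero by making all nonzero points isolated,
while keeping the neighborhoods of zero, yields a semigroup topology. -/
theorem continuousMul_nhdsAdjoint_zero {Y : Type*} [SemigroupWithZero Y]
    (τ : TopologicalSpace Y) (hmul : ContinuousMul Y) :
    @ContinuousMul Y (nhdsAdjoint 0 (𝓝 0)) _ := by
  have hcont : ∀ x y : Y, Filter.Tendsto (fun p : Y × Y => p.1 * p.2) (𝓝 x ×ˢ 𝓝 y) (𝓝 (x * y)) :=
    fun x y => by simpa only [nhds_prod_eq] using (continuous_mul (M := Y)).tendsto (x, y)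
  have hzero : @nhds Y (nhdsAdjoint 0 (𝓝 0)) 0 = 𝓝 0 := by
    rw [nhds_nhdsAdjoint_same]
    exact sup_eq_right.2 (pure_le_nhds 0)
  have hne : ∀ x : Y, x ≠ 0 → @nhds Y (nhdsAdjoint 0 (𝓝 0)) x = pure x :=
    fun x hx => nhds_nhdsAdjoint_of_ne _ hx
  have hle : ∀ x : Y, @nhds Y (nhdsAdjoint 0 (𝓝 0)) x ≤ 𝓝 x := by
    intro x
    rcases eq_or_ne x 0 with rfl | hx
    · exact hzero.le
    · exact (hne x hx).le.trans (pure_le_nhds x)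
  refine @ContinuousMul.mk Y (nhdsAdjoint 0 (𝓝 0)) _ ?_
  refine (@continuous_iff_continuousAt _ _ (_) (_) _).2 ?_
  rintro ⟨x, y⟩
  unfold ContinuousAt
  rw [@nhds_prod_eq _ _ (nhdsAdjoint 0 (𝓝 0)) (nhdsAdjoint 0 (𝓝 0))]
  by_cases hxy : x = 0 ∨ y = 0
  · have hprod : x * y = 0 := by rcases hxy with rfl | rfl <;> simp
    have key := hcont x y
    simp only [hprod] at key ⊢
    rw [hzero]
    exact key.mono_left (Filter.prod_mono (hle x) (hle y))
  · obtain ⟨hx, hy⟩ := not_or.1 hxy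
    rw [hne x hx, hne y hy, Filter.prod_pure_pure, Filter.tendsto_pure_left]
    exact fun s hs => @mem_of_mem_nhds _ (_) _ _ hs

/-- The canonical embedding of a semigroup into its `0`-extension. -/
def coeWithZeroHom (X : Type*) [Semigroup X] : X →ₙ* WithZero X where
  toFun := (↑)
  map_mul' := WithZero.coe_mul

theorem compl_range_coe_withZero (X : Type*) :
    (Set.range ((↑) : X → WithZero X))ᶜ = {0} := by
  ext y
  induction y using WithZero.recZeroCoe <;> simp

/-- If every injective homomorphism of `X` into a Hausdorff 0-discrete
topological semigroup has closed image, then `X` is zero-closed. -/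
theorem statement15 {X : Type u} [Semigroup X]
    (h : ∀ (Y : Type u) [Semigroup Y] [TopologicalSpace Y],
      ∀ [ContinuousMul Y] [T2Space Y], ∀ z : Y,
      ¬ IsOpen ({z} : Set Y) → (∀ y : Y, y ≠ z → IsOpen ({y} : Set Y)) →
      (∀ y : Y, z * y = z ∧ y * z = z) →
      ∀ f : X →ₙ* Y, Function.Injective f → IsClosed (Set.range f)) :
    ZeroClosed X := by
  intro τ hT2 hmul
  by_contra hclosed
  have hopen_iff : ∀ σ : TopologicalSpace (WithZero X),
      IsClosed[σ] (Set.range ((↑) : X → WithZero X)) ↔ IsOpen[σ] {0} := fun σ => by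
    rw [← @isOpen_compl_iff _ _ σ, compl_range_coe_withZero]
  rw [hopen_iff] at hclosed
  have hnot : ¬ IsOpen[nhdsAdjoint 0 (𝓝 0)] ({0} : Set (WithZero X)) := by
    intro ho
    exact hclosed (isOpen_singleton_iff_nhds_eq_pure _ |>.2
      (le_antisymm (Filter.le_pure_iff.2 (ho rfl)) (pure_le_nhds _)))
  have hle : nhdsAdjoint (0 : WithZero X) (𝓝 0) ≤ τ :=
    (gc_nhds 0).l_le le_rfl
  have hclosed' := @h (WithZero X) _ (nhdsAdjoint 0 (𝓝 0)) (continuousMul_nhdsAdjoint_zero τ hmul)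
    (t2Space_antitone hle hT2) 0 hnot (fun y hy => isOpen_singleton_nhdsAdjoint _ hy)
    (fun y => ⟨zero_mul y, mul_zero y⟩) (coeWithZeroHom X) WithZero.coe_injective
  exact hnot ((hopen_iff _).1 hclosed')

end ZeroClosedPaper
end
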